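/- Let g satisfy (g*), (g₀), (g∞). Let a : ℝ → ℝ be T-periodic and locally integrable, and suppose there exist α < β such that a ≥ 0 a.e. on [α,β] with ∫_α^β a > 0, and a ≤ 0 a.e. on [β, α+T] with ∫_β^{α+T} a < 0. Then for every ρ > 0 there exists λ* = λ*(ρ) > 0 such that for each λ > λ* there exist r, R with 0 < r < ρ < R and μ*(λ) > 0 such that for any μ > μ*(λ) the following holds: for every two-sided sequence S = (S_j)_{j∈ℤ} ∈ {0,1,2}^ℤ which is not identically zero there exists a solution u of u'' + (λa⁺(t) − μa⁻(t)) g(u) = 0 defined on all of ℝ with u(t) > 0 for all t, such that for each j ∈ ℤ: max_{t∈[α+jT, β+jT]} u(t) < r if S_j = 0; r < max_{t∈[α+jT, β+jT]} u(t) < ρ if S_j = 1; and ρ < max_{t∈[α+jT, β+jT]} u(t) < R if S_j = 2. -/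

import Mathlib

open MeasureTheory Set Filter Topology

/-- A Carathéodory solution of `u'' + q(t) G(u) = 0` on all of `ℝ`:
`u` is `C¹` with derivative `v`, and `v t = v t₀ - ∫_{t₀}^{t} q s * G (u s) ds`. -/
def IsSolR (q G u v : ℝ → ℝ) : Prop :=
  (∀ t, HasDerivAt u (v t) t) ∧
    ∀ t₀ t : ℝ, v t = v t₀ - ∫ s in t₀..t, q s * G (u s)

/-- Along the segment from `x₀` to `x₁`, the last zero of a function that goes from a nonpositive
to a nonnegative value. -/
theorem exists_last_zero {f : ℝ → ℝ} (hf : Continuous f) {x₀ x₁ : ℝ}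
    (h₀ : f x₀ ≤ 0) (h₁ : 0 ≤ f x₁) :
    ∃ y ∈ uIcc x₀ x₁, f y = 0 ∧ ∀ x ∈ uIcc y x₁, 0 ≤ f x := by
  have key : ∀ {f : ℝ → ℝ}, Continuous f → ∀ {x₀ x₁ : ℝ}, x₀ ≤ x₁ → f x₀ ≤ 0 → 0 ≤ f x₁ →
      ∃ y ∈ Icc x₀ x₁, f y = 0 ∧ ∀ x ∈ Icc y x₁, 0 ≤ f x := by
    intro f hf x₀ x₁ hx h₀ h₁
    have hc : IsCompact (Icc x₀ x₁ ∩ {x | f x ≤ 0}) :=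
      isCompact_Icc.inter_right (isClosed_le hf continuous_const)
    obtain ⟨y, ⟨hy, hy0⟩, hmax⟩ := hc.exists_isGreatest ⟨x₀, left_mem_Icc.2 hx, h₀⟩
    have hpos : ∀ x ∈ Icc y x₁, y < x → 0 < f x := by
      intro x hxm hlt
      by_contra hle
      exact absurd (hmax ⟨⟨hy.1.trans hxm.1, hxm.2⟩, not_lt.1 hle⟩) (not_le.2 hlt)
    have hy00 : f y = 0 := by
      refine le_antisymm hy0 ?_
      obtain ⟨w, hw, hw0⟩ : (0 : ℝ) ∈ f '' Icc y x₁ :=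
        intermediate_value_Icc hy.2 hf.continuousOn ⟨hy0, h₁⟩
      rcases hw.1.eq_or_lt with h | h
      · rw [h, hw0]
      · exact absurd hw0 (hpos w hw h).ne'
    refine ⟨y, hy, hy00, fun x hxm => ?_⟩
    rcases hxm.1.eq_or_lt with h | h
    · rw [← h, hy00]
    · exact (hpos x hxm h).le
  rcases le_total x₀ x₁ with hx | hx
  · obtain ⟨y, hy, h0, h⟩ := key hf hx h₀ h₁
    exact ⟨y, by rwa [uIcc_of_le hx], h0, by rwa [uIcc_of_le hy.2]⟩
  · obtain ⟨y, hy, h0, h⟩ := key (f := fun x => f (-x)) (x₀ := -x₀) (x₁ := -x₁)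
      (by fun_prop) (by linarith) (by simpa using h₀) (by simpa using h₁)
    refine ⟨-y, ?_, h0, ?_⟩
    · rw [uIcc_of_ge hx]
      exact ⟨by linarith [hy.2], by linarith [hy.1]⟩
    · rw [uIcc_of_ge (by linarith [hy.2])]
      intro x hx'
      simpa using h (-x) ⟨by linarith [hx'.2], by linarith [hx'.1]⟩

/-- A segment along which `f` goes from the value `a` to the value `b` while staying between. -/
theorem exists_crossing {f : ℝ → ℝ} (hf : Continuous f) {x₀ x₁ a b : ℝ} (hab : a ≤ b)
    (h₀ : f x₀ ≤ a) (h₁ : b ≤ f x₁) :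
    ∃ y₀ y₁, uIcc y₀ y₁ ⊆ uIcc x₀ x₁ ∧ f y₀ = a ∧ f y₁ = b ∧
      ∀ x ∈ uIcc y₀ y₁, a ≤ f x ∧ f x ≤ b := by
  obtain ⟨y₀, hy₀, e₀, p₀⟩ := exists_last_zero (f := fun x => f x - a) (by fun_prop)
    (x₀ := x₀) (x₁ := x₁) (by linarith) (by linarith)
  obtain ⟨y₁, hy₁, e₁, p₁⟩ := exists_last_zero (f := fun x => b - f x) (by fun_prop)
    (x₀ := x₁) (x₁ := y₀) (by linarith) (by linarith)
  have hsub : uIcc y₀ x₁ ⊆ uIcc x₀ x₁ := uIcc_subset_uIcc_right hy₀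
  have hsub' : uIcc y₀ y₁ ⊆ uIcc y₀ x₁ := uIcc_subset_uIcc_left (by rwa [uIcc_comm])
  refine ⟨y₀, y₁, hsub'.trans hsub, by linarith, by linarith, fun x hx => ⟨?_, ?_⟩⟩
  · linarith [p₀ x (hsub' hx)]
  · linarith [p₁ x (by rwa [uIcc_comm])]

/-- Impulsive discretisation of `u'' + q G(u) = 0`: `u` moves with velocity `v k` between the grid
points `z k` and `z (k + 1)`, where the velocity drops by `W k * G (u (k + 1))`. -/
structure IsDiscreteSol (z W : ℕ → ℝ) (G : ℝ → ℝ) (u v : ℕ → ℝ) : Prop where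
  pos_step : ∀ k, u (k + 1) = u k + (z (k + 1) - z k) * v k
  vel_step : ∀ k, v (k + 1) = v k - W k * G (u (k + 1))

namespace IsDiscreteSol

variable {z W u v : ℕ → ℝ} {G : ℝ → ℝ}

theorem vel_eq (h : IsDiscreteSol z W G u v) {i j : ℕ} (hij : i ≤ j) :
    v j = v i - ∑ k ∈ Finset.Ico i j, W k * G (u (k + 1)) := by
  induction j, hij using Nat.le_induction with
  | base => simp
  | succ j hj ih => rw [Finset.sum_Ico_succ_top hj, h.vel_step, ih]; ring

theorem pos_le (h : IsDiscreteSol z W G u v) (hz : Monotone z) {i j : ℕ} {c : ℝ} (hij : i ≤ j)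
    (hc : ∀ k, i ≤ k → k < j → v k ≤ c) : u j ≤ u i + (z j - z i) * c := by
  induction j, hij using Nat.le_induction with
  | base => simp
  | succ j hj ih =>
    have h1 := ih fun k hk hk' => hc k hk (by omega)
    have h2 := mul_le_mul_of_nonneg_left (hc j hj (by omega)) (sub_nonneg.2 (hz j.le_succ))
    rw [h.pos_step]
    simp only [Nat.succ_eq_add_one] at *
    linarith

theorem le_pos (h : IsDiscreteSol z W G u v) (hz : Monotone z) {i j : ℕ} {c : ℝ} (hij : i ≤ j)
    (hc : ∀ k, i ≤ k → k < j → c ≤ v k) : u i + (z j - z i) * c ≤ u j := by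
  induction j, hij using Nat.le_induction with
  | base => simp
  | succ j hj ih =>
    have h1 := ih fun k hk hk' => hc k hk (by omega)
    have h2 := mul_le_mul_of_nonneg_left (hc j hj (by omega)) (sub_nonneg.2 (hz j.le_succ))
    rw [h.pos_step]
    simp only [Nat.succ_eq_add_one] at *
    linarith

/-- Velocities decrease where the weight is nonnegative. -/
theorem vel_anti (h : IsDiscreteSol z W G u v) (hG : ∀ s, 0 ≤ G s) {p q : ℕ}
    (hW : ∀ k, p ≤ k → k < q → 0 ≤ W k) {i j : ℕ} (hi : p ≤ i) (hij : i ≤ j) (hj : j ≤ q) :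
    v j ≤ v i := by
  rw [h.vel_eq hij]
  have : 0 ≤ ∑ k ∈ Finset.Ico i j, W k * G (u (k + 1)) := Finset.sum_nonneg fun k hk => by
    rw [Finset.mem_Ico] at hk
    exact mul_nonneg (hW k (by omega) (by omega)) (hG _)
  linarith

/-- Velocities increase where the weight is nonpositive. -/
theorem vel_mono (h : IsDiscreteSol z W G u v) (hG : ∀ s, 0 ≤ G s) {p q : ℕ}
    (hW : ∀ k, p ≤ k → k < q → W k ≤ 0) {i j : ℕ} (hi : p ≤ i) (hij : i ≤ j) (hj : j ≤ q) :
    v i ≤ v j := by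
  rw [h.vel_eq hij]
  have : ∑ k ∈ Finset.Ico i j, W k * G (u (k + 1)) ≤ 0 := Finset.sum_nonpos fun k hk => by
    rw [Finset.mem_Ico] at hk
    exact mul_nonpos_of_nonpos_of_nonneg (hW k (by omega) (by omega)) (hG _)
  linarith

theorem concave (h : IsDiscreteSol z W G u v) (hz : Monotone z) (hG : ∀ s, 0 ≤ G s) {p q : ℕ}
    (hW : ∀ k, p ≤ k → k < q → 0 ≤ W k) {i j k : ℕ} (hi : p ≤ i) (hij : i ≤ j) (hjk : j ≤ k)
    (hk : k ≤ q) : (z k - z j) * u i + (z j - z i) * u k ≤ (z k - z i) * u j := by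
  have h1 : u i + (z j - z i) * v j ≤ u j :=
    h.le_pos hz hij fun l hl hl' => h.vel_anti hG hW (by omega) hl'.le (by omega)
  have h2 : u k ≤ u j + (z k - z j) * v j :=
    h.pos_le hz hjk fun l hl hl' => h.vel_anti hG hW (by omega) hl (by omega)
  have h3 := mul_le_mul_of_nonneg_left h1 (sub_nonneg.2 (hz hjk))
  have h4 := mul_le_mul_of_nonneg_left h2 (sub_nonneg.2 (hz hij))
  linarith

theorem le_of_convex (h : IsDiscreteSol z W G u v) (hz : StrictMono z) (hG : ∀ s, 0 ≤ G s)
    {p q : ℕ} (hW : ∀ k, p ≤ k → k < q → W k ≤ 0) {j : ℕ} (hi : p ≤ j) (hj : j ≤ q) {b : ℝ}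
    (hp : u p ≤ b) (hq : u q ≤ b) : u j ≤ b := by
  have h1 : u j ≤ u p + (z j - z p) * v j :=
    h.pos_le hz.monotone hi fun l hl hl' => h.vel_mono hG hW (by omega) hl'.le (by omega)
  have h2 : u j + (z q - z j) * v j ≤ u q :=
    h.le_pos hz.monotone hj fun l hl hl' => h.vel_mono hG hW (by omega) hl (by omega)
  have a1 := sub_nonneg.2 (hz.monotone hi)
  have a2 := sub_nonneg.2 (hz.monotone hj)
  rcases le_total (v j) 0 with hv | hv
  · nlinarith
  · nlinarith

/-- A nonnegative discrete solution that is tangent to zero stays at zero. -/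
theorem eq_zero_of_tangent (h : IsDiscreteSol z W G u v) (hG0 : G 0 = 0) {i : ℕ}
    (hu : u i = 0) (hv : v i = 0) {j : ℕ} (hij : i ≤ j) : u j = 0 ∧ v j = 0 := by
  induction j, hij using Nat.le_induction with
  | base => exact ⟨hu, hv⟩
  | succ j hj ih =>
    have : u (j + 1) = 0 := by rw [h.pos_step, ih.1, ih.2]; ring
    exact ⟨this, by rw [h.vel_step, this, ih.2, hG0]; ring⟩

/-- A nonnegative discrete solution starting at rest and vanishing somewhere up to index `E`
vanishes at `E`, with nonpositive velocity. -/
theorem end_of_zero (h : IsDiscreteSol z W G u v) (hz : StrictMono z) (hG0 : G 0 = 0)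
    (hv0 : v 0 = 0) {E k : ℕ} (hu : ∀ k ≤ E, 0 ≤ u k) (hk : k ≤ E) (huk : u k = 0) :
    u E = 0 ∧ v E ≤ 0 := by
  have main : v k ≤ 0 := by
    rcases k with _ | k
    · exact hv0.le
    · have h1 := hu k (by omega)
      have h2 := h.pos_step k
      have h3 := sub_pos.2 (hz k.lt_succ_self)
      rw [h.vel_step, huk, hG0]
      simp only [Nat.succ_eq_add_one] at h3
      by_contra hc
      push Not at hc
      nlinarith
  rcases hk.eq_or_lt with rfl | hlt
  · exact ⟨huk, main⟩
  · have h1 := hu (k + 1) hlt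
    rw [h.pos_step, huk, zero_add] at h1
    have h3 := sub_pos.2 (hz k.lt_succ_self)
    have hvk : v k = 0 := le_antisymm main (nonneg_of_mul_nonneg_right h1 h3)
    have := h.eq_zero_of_tangent hG0 huk hvk hk
    exact ⟨this.1, this.2.le⟩

/-- On a stretch of large nonnegative weight, a nonnegative discrete solution cannot have
maximum exactly `L`. -/
theorem not_max_eq (h : IsDiscreteSol z W G u v) (hz : StrictMono z) (hG : ∀ s, 0 ≤ G s)
    {p₀ p₁ p₂ p₃ m : ℕ} (h01 : p₀ ≤ p₁) (h12 : p₁ ≤ p₂) (h23 : p₂ ≤ p₃)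
    (hW : ∀ k, p₀ ≤ k → k < p₃ → 0 ≤ W k) {L e A γ c : ℝ} (hL : 0 < L) (he : 0 < e)
    (hγ : 0 ≤ γ)
    (e1 : z p₁ - z p₀ = e) (e2 : z p₃ - z p₂ = e) (eA : z p₃ - z p₀ = A)
    (hu : ∀ k, p₀ ≤ k → k ≤ p₃ → 0 ≤ u k ∧ u k ≤ L) (hm : p₀ ≤ m ∧ m ≤ p₃) (hum : u m = L)
    (hGγ : ∀ s, L * e / A ≤ s → s ≤ L → γ ≤ G s)
    (hc : c ≤ ∑ k ∈ Finset.Ico p₁ p₂, W k) (hbig : L < e * (c * γ / 2)) : False := by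
  have hzm := hz.monotone
  have hA : 0 < A := by
    have := hzm h12
    have := hzm h23
    linarith
  have low : ∀ k, p₁ ≤ k → k ≤ p₂ → L * e / A ≤ u k := by
    intro k hk hk'
    rw [div_le_iff₀ hA]
    have huk := hu k (by omega) (by omega)
    have b1 := hzm hk
    have b2 := hzm hk'
    have b3 := hzm hm.1
    have b4 := hzm hm.2
    rcases le_total k m with hkm | hkm
    · have h1 := h.concave hzm hG hW le_rfl (h01.trans hk) hkm hm.2
      have h2 := hu p₀ le_rfl (by omega)
      have b5 := hzm hkm
      rw [hum] at h1
      nlinarith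
    · have h1 := h.concave hzm hG hW hm.1 hkm (hk'.trans h23) le_rfl
      have h2 := hu p₃ (by omega) le_rfl
      have b5 := hzm hkm
      rw [hum] at h1
      nlinarith
  have drop : c * γ ≤ v p₁ - v p₂ := by
    have h1 := h.vel_eq h12
    have h2 : c * γ ≤ ∑ k ∈ Finset.Ico p₁ p₂, W k * G (u (k + 1)) := by
      calc c * γ ≤ (∑ k ∈ Finset.Ico p₁ p₂, W k) * γ := mul_le_mul_of_nonneg_right hc hγ
        _ = ∑ k ∈ Finset.Ico p₁ p₂, W k * γ := Finset.sum_mul ..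
        _ ≤ _ := Finset.sum_le_sum fun k hk => by
          rw [Finset.mem_Ico] at hk
          exact mul_le_mul_of_nonneg_left
            (hGγ _ (low _ (by omega) (by omega)) (hu _ (by omega) (by omega)).2)
            (hW k (by omega) (by omega))
    linarith
  rcases le_total (c * γ / 2) (v p₁) with hv | hv
  · have h1 := h.le_pos hzm h01 (c := c * γ / 2) fun k hk hk' =>
      hv.trans (h.vel_anti hG hW hk hk'.le (by omega))
    have h2 := hu p₀ le_rfl (by omega)
    have h3 := hu p₁ (by omega) (by omega)
    rw [e1] at h1
    linarith
  · have h1 := h.pos_le hzm h23 (c := -(c * γ / 2)) fun k hk hk' =>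
      (h.vel_anti hG hW (by omega) hk (by omega)).trans (by linarith)
    have h2 := hu p₂ (by omega) (by omega)
    have h3 := hu p₃ (by omega) (by omega)
    rw [e2] at h1
    linarith

/-- If the maximum over a stretch of nonnegative weight is a level `L` at which `G` is small
compared to `L`, then the solution stays nonnegative over the following stretch of very negative
weight and is above `R` at its end. -/
theorem expelled (h : IsDiscreteSol z W G u v) (hz : StrictMono z) (hG : ∀ s, 0 ≤ G s)
    {p₀ m₀ m₁ m₂ m₃ m : ℕ} (h00 : p₀ ≤ m₀) (h01 : m₀ ≤ m₁) (h12 : m₁ ≤ m₂) (h23 : m₂ ≤ m₃)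
    (hW : ∀ k, p₀ ≤ k → k < m₀ → 0 ≤ W k) (hW' : ∀ k, m₀ ≤ k → k < m₃ → W k ≤ 0)
    {L R δ w e γ d : ℝ} (hL : 0 < L) (hLR : L ≤ R) (hδ : 0 ≤ δ) (hγ : 0 ≤ γ)
    (hv0 : 0 ≤ v p₀) (hu0 : 0 ≤ u p₀) (hu : ∀ k, p₀ ≤ k → k ≤ m₀ → u k ≤ L)
    (hm : p₀ ≤ m ∧ m ≤ m₀) (hum : u m = L)
    (hGδ : ∀ s ≤ L, G s ≤ δ * L) (hw : ∑ k ∈ Finset.Ico p₀ m₀, W k ≤ w) (hw0 : 0 ≤ w)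
    (hsmall : (z m₃ - z p₀) * (w * δ) ≤ 1 / 2)
    (hGγ : ∀ s, L / 2 ≤ s → s ≤ R → γ ≤ G s)
    (e2 : z m₃ - z m₂ = e) (hd : d ≤ ∑ k ∈ Finset.Ico m₁ m₂, -W k) (hbig : 2 * R ≤ e * (d * γ)) :
    (∀ k, p₀ ≤ k → k ≤ m₃ → 0 ≤ u k) ∧ R ≤ u m₃ := by
  have hzm := hz.monotone
  have vlow0 : ∀ k, p₀ ≤ k → k ≤ m₀ → -(w * δ * L) ≤ v k := by
    intro k hk hk'
    have h1 : ∑ i ∈ Finset.Ico p₀ k, W i * G (u (i + 1)) ≤ w * δ * L := by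
      calc _ ≤ ∑ i ∈ Finset.Ico p₀ k, W i * (δ * L) := Finset.sum_le_sum fun i hi => by
            rw [Finset.mem_Ico] at hi
            exact mul_le_mul_of_nonneg_left (hGδ _ (hu _ (by omega) (by omega)))
              (hW i (by omega) (by omega))
        _ = (∑ i ∈ Finset.Ico p₀ k, W i) * (δ * L) := (Finset.sum_mul ..).symm
        _ ≤ (∑ i ∈ Finset.Ico p₀ m₀, W i) * (δ * L) := by
            refine mul_le_mul_of_nonneg_right ?_ (by positivity)
            refine Finset.sum_le_sum_of_subset_of_nonneg (Finset.Ico_subset_Ico_right hk') ?_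
            intro i hi _
            rw [Finset.mem_Ico] at hi
            exact hW i hi.1 hi.2
        _ ≤ w * (δ * L) := mul_le_mul_of_nonneg_right hw (by positivity)
        _ = _ := by ring
    have h2 := h.vel_eq hk
    linarith
  have vlow : ∀ k, p₀ ≤ k → k ≤ m₃ → -(w * δ * L) ≤ v k := by
    intro k hk hk'
    rcases le_total k m₀ with hkm | hkm
    · exact vlow0 k hk hkm
    · exact (vlow0 m₀ h00 le_rfl).trans (h.vel_mono hG hW' le_rfl hkm hk')
  have ulow : ∀ k, m ≤ k → k ≤ m₃ → L / 2 ≤ u k := by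
    intro k hk hk'
    have h1 := h.le_pos hzm hk fun i hi hi' => vlow i (by omega) (by omega)
    have b1 := hzm hm.1
    have b2 := hzm hk'
    have b3 : (z k - z m) * (w * δ) ≤ (z m₃ - z p₀) * (w * δ) :=
      mul_le_mul_of_nonneg_right (by linarith) (by positivity)
    rw [hum] at h1
    nlinarith
  refine ⟨fun k hk hk' => ?_, ?_⟩
  · rcases le_total m k with hmk | hmk
    · exact le_trans (by linarith) (ulow k hmk hk')
    · rcases hmk.eq_or_lt with rfl | hlt
      · linarith
      · have h1 := h.concave hzm hG hW le_rfl hk hmk hm.2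
        have b1 := hzm hk
        have b2 := hz hlt
        rw [hum] at h1
        have : 0 ≤ (z m - z p₀) * u k :=
          le_trans (add_nonneg (mul_nonneg (by linarith) hu0) (mul_nonneg (by linarith) hL.le)) h1
        exact nonneg_of_mul_nonneg_right this (by linarith)
  · by_contra hlt
    push Not at hlt
    have uR : ∀ k, m₀ ≤ k → k ≤ m₃ → u k ≤ R := fun k hk hk' =>
      h.le_of_convex hz hG hW' hk hk' ((hu m₀ h00 le_rfl).trans hLR) hlt.le
    have h1 := h.vel_eq h12
    have h2 : d * γ ≤ ∑ k ∈ Finset.Ico m₁ m₂, -W k * G (u (k + 1)) := by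
      calc d * γ ≤ (∑ k ∈ Finset.Ico m₁ m₂, -W k) * γ := mul_le_mul_of_nonneg_right hd hγ
        _ = ∑ k ∈ Finset.Ico m₁ m₂, -W k * γ := Finset.sum_mul ..
        _ ≤ _ := Finset.sum_le_sum fun k hk => by
          rw [Finset.mem_Ico] at hk
          exact mul_le_mul_of_nonneg_left
            (hGγ _ (ulow _ (by omega) (by omega)) (uR _ (by omega) (by omega)))
            (neg_nonneg.2 (hW' k (by omega) (by omega)))
    simp only [neg_mul, Finset.sum_neg_distrib] at h2
    have h3 := vlow m₁ (by omega) (by omega)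
    have h4 := h.le_pos hzm h23 (c := d * γ - w * δ * L) fun k hk hk' =>
      le_trans (by linarith) (h.vel_mono hG hW' (i := m₂) (by omega) hk (by omega))
    have h5 := ulow m₂ (by omega) (by omega)
    rw [e2] at h4
    have b1 : e ≤ z m₃ - z p₀ := by
      have := hzm (show p₀ ≤ m₂ by omega)
      linarith
    have h6 : e * (w * δ) ≤ 1 / 2 :=
      (mul_le_mul_of_nonneg_right b1 (by positivity)).trans hsmall
    nlinarith

/-- After a stretch of very negative weight, a nonnegative solution with value in `[r, R]` has
nonnegative velocity. -/
theorem entry (h : IsDiscreteSol z W G u v) (hz : StrictMono z) (hG : ∀ s, 0 ≤ G s)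
    {m₀ m₁ m₂ m₃ : ℕ} (h01 : m₀ ≤ m₁) (h12 : m₁ ≤ m₂) (h23 : m₂ ≤ m₃)
    (hW' : ∀ k, m₀ ≤ k → k < m₃ → W k ≤ 0) {r R e γ d : ℝ} (hγ : 0 ≤ γ)
    (hR : 0 < R) (hu : ∀ k, m₀ ≤ k → k ≤ m₃ → 0 ≤ u k) (hu0 : u m₀ ≤ R)
    (hr : r ≤ u m₃) (hGγ : ∀ s, r ≤ s → s ≤ R → γ ≤ G s)
    (e1 : z m₁ - z m₀ = e) (hd : d ≤ ∑ k ∈ Finset.Ico m₁ m₂, -W k)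
    (hbig : 2 * R ≤ e * (d * γ)) : 0 ≤ v m₃ := by
  have hzm := hz.monotone
  by_contra hlt
  push Not at hlt
  have vneg : ∀ k, m₀ ≤ k → k ≤ m₃ → v k ≤ 0 := fun k hk hk' =>
    (h.vel_mono hG hW' hk hk' le_rfl).trans hlt.le
  have ulow : ∀ k, m₀ ≤ k → k ≤ m₃ → r ≤ u k := fun k hk hk' => by
    have := h.pos_le hzm hk' (c := 0) fun i hi hi' => vneg i (by omega) (by omega)
    linarith
  have uup : ∀ k, m₀ ≤ k → k ≤ m₃ → u k ≤ R := fun k hk hk' => by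
    have := h.pos_le hzm hk (c := 0) fun i hi hi' => vneg i (by omega) (by omega)
    linarith
  have h1 := h.vel_eq h12
  have h2 : d * γ ≤ ∑ k ∈ Finset.Ico m₁ m₂, -W k * G (u (k + 1)) := by
    calc d * γ ≤ (∑ k ∈ Finset.Ico m₁ m₂, -W k) * γ := mul_le_mul_of_nonneg_right hd hγ
      _ = ∑ k ∈ Finset.Ico m₁ m₂, -W k * γ := Finset.sum_mul ..
      _ ≤ _ := Finset.sum_le_sum fun k hk => by
        rw [Finset.mem_Ico] at hk
        exact mul_le_mul_of_nonneg_left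
          (hGγ _ (ulow _ (by omega) (by omega)) (uup _ (by omega) (by omega)))
          (neg_nonneg.2 (hW' k (by omega) (by omega)))
  simp only [neg_mul, Finset.sum_neg_distrib] at h2
  have h3 := vneg m₂ (by omega) (by omega)
  have h4 := h.pos_le hzm h01 (c := -(d * γ)) fun k hk hk' =>
    (h.vel_mono hG hW' hk hk'.le (by omega)).trans (by linarith)
  have h5 := hu m₁ (by omega) (by omega)
  rw [e1] at h4
  nlinarith

end IsDiscreteSol

/-- The discrete solution starting at rest from height `x`, as pairs (position, velocity). -/
noncomputable def shoot (z W : ℕ → ℝ) (G : ℝ → ℝ) (x : ℝ) : ℕ → ℝ × ℝ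
  | 0 => (x, 0)
  | k + 1 =>
    let y := (shoot z W G x k).1 + (z (k + 1) - z k) * (shoot z W G x k).2
    (y, (shoot z W G x k).2 - W k * G y)

theorem isDiscreteSol_shoot (z W : ℕ → ℝ) (G : ℝ → ℝ) (x : ℝ) :
    IsDiscreteSol z W G (fun k => (shoot z W G x k).1) (fun k => (shoot z W G x k).2) :=
  ⟨fun _ => rfl, fun _ => rfl⟩

theorem continuous_shoot (z W : ℕ → ℝ) {G : ℝ → ℝ} (hG : Continuous G) (k : ℕ) :
    Continuous fun x => shoot z W G x k := by
  induction k with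
  | zero => simp only [shoot]; fun_prop
  | succ k ih => simp only [shoot]; fun_prop

/-- Maximum of a sequence over the `N + 1` grid points of the `n`-th positivity interval. -/
noncomputable def blockMax (N : ℕ) (u : ℕ → ℝ) (n : ℕ) : ℝ :=
  (Finset.range (N + 1)).sup' Finset.nonempty_range_add_one fun i => u (2 * N * n + i)

theorem le_blockMax {N n k : ℕ} (u : ℕ → ℝ) (h1 : 2 * N * n ≤ k) (h2 : k ≤ 2 * N * n + N) :
    u k ≤ blockMax N u n := by
  have := Finset.le_sup' (fun i => u (2 * N * n + i))
    (Finset.mem_range.2 (show k - 2 * N * n < N + 1 by omega))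
  rwa [show 2 * N * n + (k - 2 * N * n) = k by omega] at this

theorem exists_eq_blockMax (N : ℕ) (u : ℕ → ℝ) (n : ℕ) :
    ∃ k, 2 * N * n ≤ k ∧ k ≤ 2 * N * n + N ∧ u k = blockMax N u n := by
  obtain ⟨i, hi, h⟩ := Finset.exists_mem_eq_sup' (Finset.nonempty_range_add_one (n := N))
    fun i => u (2 * N * n + i)
  rw [Finset.mem_range] at hi
  exact ⟨2 * N * n + i, by omega, by omega, h.symm⟩

/-- A grid made of blocks of `2 * N` cells: `N` cells of nonnegative weight, then `N` cells of
nonpositive weight, with quantitative information away from the ends of each half. -/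
structure BlockGrid (z W : ℕ → ℝ) (N N' : ℕ) (A T e e' c w d : ℝ) : Prop where
  mono : StrictMono z
  two_mul_le : 2 * N' ≤ N
  weight_nonneg : ∀ n k, 2 * N * n ≤ k → k < 2 * N * n + N → 0 ≤ W k
  weight_nonpos : ∀ n k, 2 * N * n + N ≤ k → k < 2 * N * (n + 1) → W k ≤ 0
  left_pos : ∀ n, z (2 * N * n + N') - z (2 * N * n) = e
  right_pos : ∀ n, z (2 * N * n + N) - z (2 * N * n + (N - N')) = e
  length_pos : ∀ n, z (2 * N * n + N) - z (2 * N * n) = A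
  left_neg : ∀ n, z (2 * N * n + N + N') - z (2 * N * n + N) = e'
  right_neg : ∀ n, z (2 * N * (n + 1)) - z (2 * N * n + N + (N - N')) = e'
  period : ∀ n, z (2 * N * (n + 1)) - z (2 * N * n) = T
  sum_mid_pos : ∀ n, c ≤ ∑ k ∈ Finset.Ico (2 * N * n + N') (2 * N * n + (N - N')), W k
  sum_pos : ∀ n, ∑ k ∈ Finset.Ico (2 * N * n) (2 * N * n + N), W k ≤ w
  sum_mid_neg : ∀ n,
    d ≤ ∑ k ∈ Finset.Ico (2 * N * n + N + N') (2 * N * n + N + (N - N')), -W k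

/-- Smallness of the nonlinearity `G` below the levels `r₀, r₁, R`, and largeness of the weights
relative to `G` at the levels `ρ₁, ρ₂` and on `[r₀ / 2, R]`. -/
structure Levels (G : ℝ → ℝ) (A T e e' c w d r₀ r₁ ρ₁ ρ₂ R : ℝ) : Prop where
  cont : Continuous G
  nonneg : ∀ s, 0 ≤ G s
  map_zero : G 0 = 0
  e_pos : 0 < e
  w_nonneg : 0 ≤ w
  r₀_pos : 0 < r₀
  r₀_lt : r₀ < r₁
  r₁_lt : r₁ < ρ₁
  ρ₁_lt : ρ₁ < ρ₂
  ρ₂_lt : ρ₂ < R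
  small : ∃ δ, 0 ≤ δ ∧ T * (w * δ) ≤ 1 / 2 ∧ ∀ L, L = r₀ ∨ L = r₁ ∨ L = R → ∀ s ≤ L, G s ≤ δ * L
  large_neg : ∃ γ, 0 ≤ γ ∧ 2 * R ≤ e' * (d * γ) ∧ ∀ s, r₀ / 2 ≤ s → s ≤ R → γ ≤ G s
  large_pos : ∀ L, L = ρ₁ ∨ L = ρ₂ →
    ∃ γ, 0 ≤ γ ∧ L < e * (c * γ / 2) ∧ ∀ s, L * e / A ≤ s → s ≤ L → γ ≤ G s

/-- The closed range of maxima encoded by a symbol. -/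
def InRange (r₀ r₁ ρ₁ ρ₂ R : ℝ) (i : Fin 3) (M : ℝ) : Prop :=
  (i = 0 → M ≤ r₀) ∧ (i = 1 → r₁ ≤ M ∧ M ≤ ρ₁) ∧ (i = 2 → ρ₂ ≤ M ∧ M ≤ R)

theorem InRange.le {r₀ r₁ ρ₁ ρ₂ R M : ℝ} {i : Fin 3} (h : InRange r₀ r₁ ρ₁ ρ₂ R i M)
    (h₀ : r₀ ≤ R) (h₁ : ρ₁ ≤ R) : M ≤ R := by
  obtain ⟨a, b, c⟩ := h
  fin_cases i
  · exact (a rfl).trans h₀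
  · exact (b rfl).2.trans h₁
  · exact (c rfl).2

section Finite

variable {z W : ℕ → ℝ} {G : ℝ → ℝ} {N N' : ℕ} {A T e e' c w d r₀ r₁ ρ₁ ρ₂ R : ℝ}

/-- If the maximum over a positivity interval is one of the levels `r₀, r₁, R`, the solution is
nonnegative up to the next positivity interval, where it starts above `R`. -/
theorem expelled_of_blockMax (hgrid : BlockGrid z W N N' A T e e' c w d)
    (hlev : Levels G A T e e' c w d r₀ r₁ ρ₁ ρ₂ R) {u v : ℕ → ℝ} (h : IsDiscreteSol z W G u v)
    {n : ℕ} (hu0 : 0 ≤ u (2 * N * n))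
    (hentry : r₀ ≤ u (2 * N * n) → u (2 * N * n) ≤ R → 0 ≤ v (2 * N * n)) {L : ℝ}
    (hL : L = r₀ ∨ L = r₁ ∨ L = R) (hM : blockMax N u n = L) :
    (∀ k, 2 * N * n ≤ k → k ≤ 2 * N * (n + 1) → 0 ≤ u k) ∧ R ≤ u (2 * N * (n + 1)) := by
  obtain ⟨δ, hδ, hTδ, hsm⟩ := hlev.small
  obtain ⟨γ, hγ, hbig, hGγ⟩ := hlev.large_neg
  obtain ⟨m, hm1, hm2, hm⟩ := exists_eq_blockMax N u n
  have o1 := hlev.r₀_pos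
  have o2 := hlev.r₀_lt
  have o3 := hlev.r₁_lt
  have o4 := hlev.ρ₁_lt
  have o5 := hlev.ρ₂_lt
  have hLr : r₀ ≤ L ∧ L ≤ R := by rcases hL with rfl | rfl | rfl <;> constructor <;> linarith
  have hN := hgrid.two_mul_le
  have hE : 2 * N * (n + 1) = 2 * N * n + 2 * N := by ring
  have hle : ∀ k, 2 * N * n ≤ k → k ≤ 2 * N * n + N → u k ≤ L :=
    fun k hk hk' => hM ▸ le_blockMax u hk hk'
  have hv0 : 0 ≤ v (2 * N * n) := by
    by_contra hv
    push Not at hv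
    have h1 := h.pos_le hgrid.mono.monotone hm1 (c := v (2 * N * n)) fun k hk hk' =>
      h.vel_anti hlev.nonneg (hgrid.weight_nonneg n) le_rfl hk (by omega)
    have h2 := hgrid.mono.monotone hm1
    have h3 : u m ≤ u (2 * N * n) := by nlinarith
    have h4 := hle _ le_rfl (by omega)
    exact absurd (hentry (by linarith) (by linarith)) (not_le.2 hv)
  exact h.expelled hgrid.mono hlev.nonneg (p₀ := 2 * N * n) (m₀ := 2 * N * n + N)
    (m₁ := 2 * N * n + N + N') (m₂ := 2 * N * n + N + (N - N')) (m := m)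
    (by omega) (by omega) (by omega) (by omega)
    (hgrid.weight_nonneg n) (hgrid.weight_nonpos n) (by linarith) hLr.2 hδ hγ hv0 hu0 hle
    ⟨hm1, hm2⟩ (hm.trans hM) (hsm L hL) (hgrid.sum_pos n) hlev.w_nonneg
    (by rw [hgrid.period]; exact hTδ) (fun s hs hs' => hGγ s (by linarith) hs')
    (hgrid.right_neg n) (hgrid.sum_mid_neg n) hbig

/-- If the maximum over a positivity interval is one of the levels `ρ₁, ρ₂`, the solution becomes
negative there. -/
theorem exists_neg_of_blockMax (hgrid : BlockGrid z W N N' A T e e' c w d)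
    (hlev : Levels G A T e e' c w d r₀ r₁ ρ₁ ρ₂ R) {u v : ℕ → ℝ} (h : IsDiscreteSol z W G u v)
    {n : ℕ} {L : ℝ} (hL : L = ρ₁ ∨ L = ρ₂) (hM : blockMax N u n = L) :
    ∃ k, 2 * N * n ≤ k ∧ k ≤ 2 * N * n + N ∧ u k < 0 := by
  by_contra! hcon
  obtain ⟨γ, hγ, hbig, hGγ⟩ := hlev.large_pos L hL
  obtain ⟨m, hm1, hm2, hm⟩ := exists_eq_blockMax N u n
  have o1 := hlev.r₀_pos
  have o2 := hlev.r₀_lt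
  have o3 := hlev.r₁_lt
  have o4 := hlev.ρ₁_lt
  have hN := hgrid.two_mul_le
  exact h.not_max_eq hgrid.mono hlev.nonneg (p₀ := 2 * N * n) (p₁ := 2 * N * n + N')
    (p₂ := 2 * N * n + (N - N')) (p₃ := 2 * N * n + N) (by omega) (by omega) (by omega)
    (hgrid.weight_nonneg n) (by rcases hL with rfl | rfl <;> linarith) hlev.e_pos hγ
    (hgrid.left_pos n) (hgrid.right_pos n) (hgrid.length_pos n)
    (fun k hk hk' => ⟨hcon k hk hk', hM ▸ le_blockMax u hk hk'⟩) ⟨hm1, hm2⟩ (hm.trans hM)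
    hGγ (hgrid.sum_mid_pos n) hbig

/-- The segment of initial heights from `x₀` to `x₁` realizes the first `n` symbols of `S` and is
stretched from height zero to height `R` at the beginning of block `n`. -/
structure Stretched (z W : ℕ → ℝ) (G : ℝ → ℝ) (N : ℕ) (r₀ r₁ ρ₁ ρ₂ R : ℝ) (S : ℕ → Fin 3)
    (n : ℕ) (x₀ x₁ : ℝ) : Prop where
  nonneg : ∀ x ∈ uIcc x₀ x₁, ∀ k ≤ 2 * N * n, 0 ≤ (shoot z W G x k).1
  range : ∀ x ∈ uIcc x₀ x₁, ∀ j < n,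
    InRange r₀ r₁ ρ₁ ρ₂ R (S j) (blockMax N (fun k => (shoot z W G x k).1) j)
  entry : ∀ x ∈ uIcc x₀ x₁, r₀ ≤ (shoot z W G x (2 * N * n)).1 →
    (shoot z W G x (2 * N * n)).1 ≤ R → 0 ≤ (shoot z W G x (2 * N * n)).2
  zero : (shoot z W G x₀ (2 * N * n)).1 = 0 ∧ (shoot z W G x₀ (2 * N * n)).2 ≤ 0
  large : R ≤ (shoot z W G x₁ (2 * N * n)).1

theorem continuous_blockMax (z W : ℕ → ℝ) (hG : Continuous G) (N n : ℕ) :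
    Continuous fun x => blockMax N (fun k => (shoot z W G x k).1) n :=
  Continuous.finset_sup'_apply _ fun _ _ => continuous_fst.comp (continuous_shoot z W hG _)

/-- Inside a stretched segment there is a segment along which the maximum over the next positivity
interval has the prescribed range, from a solution with a nonpositive value to one which is
expelled. -/
theorem Stretched.exists_subsegment (hgrid : BlockGrid z W N N' A T e e' c w d)
    (hlev : Levels G A T e e' c w d r₀ r₁ ρ₁ ρ₂ R) {S : ℕ → Fin 3} {n : ℕ} {x₀ x₁ : ℝ}
    (hs : Stretched z W G N r₀ r₁ ρ₁ ρ₂ R S n x₀ x₁) :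
    ∃ y₀ y₁ L, uIcc y₀ y₁ ⊆ uIcc x₀ x₁ ∧
      (∀ x ∈ uIcc y₀ y₁,
        InRange r₀ r₁ ρ₁ ρ₂ R (S n) (blockMax N (fun k => (shoot z W G x k).1) n)) ∧
      (∃ k ≤ 2 * N * (n + 1), (shoot z W G y₀ k).1 ≤ 0) ∧
      (L = r₀ ∨ L = r₁ ∨ L = R) ∧ blockMax N (fun k => (shoot z W G y₁ k).1) n = L := by
  have o1 := hlev.r₀_pos
  have o2 := hlev.r₀_lt
  have o3 := hlev.r₁_lt
  have o4 := hlev.ρ₁_lt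
  have o5 := hlev.ρ₂_lt
  have hE : 2 * N * (n + 1) = 2 * N * n + 2 * N := by ring
  have hcont := continuous_blockMax z W hlev.cont N n
  have hM₀ : blockMax N (fun k => (shoot z W G x₀ k).1) n ≤ 0 := by
    obtain ⟨m, hm1, hm2, hm⟩ := exists_eq_blockMax N (fun k => (shoot z W G x₀ k).1) n
    have h := isDiscreteSol_shoot z W G x₀
    have h1 := h.pos_le hgrid.mono.monotone hm1 (c := 0) fun k hk hk' =>
      (h.vel_anti hlev.nonneg (hgrid.weight_nonneg n) le_rfl hk (by omega)).trans hs.zero.2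
    rw [← hm]
    have := hs.zero.1
    linarith
  have hM₁ : R ≤ blockMax N (fun k => (shoot z W G x₁ k).1) n :=
    hs.large.trans (le_blockMax (fun k => (shoot z W G x₁ k).1) le_rfl (by omega))
  have neg : ∀ y L, L = ρ₁ ∨ L = ρ₂ → blockMax N (fun k => (shoot z W G y k).1) n = L →
      ∃ k ≤ 2 * N * (n + 1), (shoot z W G y k).1 ≤ 0 := by
    intro y L hL hM
    obtain ⟨k, -, hk, hlt⟩ := exists_neg_of_blockMax hgrid hlev (isDiscreteSol_shoot z W G y) hL hM
    exact ⟨k, by omega, hlt.le⟩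
  have hS : S n = 0 ∨ S n = 1 ∨ S n = 2 := by
    generalize S n = i
    fin_cases i <;> simp
  rcases hS with h | h | h
  · obtain ⟨y, hy, e0, hle⟩ := exists_last_zero
      (f := fun x => r₀ - blockMax N (fun k => (shoot z W G x k).1) n) (by fun_prop)
      (x₀ := x₁) (x₁ := x₀) (by linarith) (by linarith)
    refine ⟨x₀, y, r₀, uIcc_subset_uIcc_left (by rwa [uIcc_comm]), fun x hx => ?_,
      ⟨2 * N * n, by omega, hs.zero.1.le⟩, Or.inl rfl, by linarith⟩
    have := hle x (by rwa [uIcc_comm])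
    simp [InRange, h]
    linarith
  · obtain ⟨y₀, y₁, hsub, e0, e1, hr⟩ := exists_crossing hcont o3.le
      (x₀ := x₀) (x₁ := x₁) (by linarith) (by linarith)
    refine ⟨y₁, y₀, r₁, by rwa [uIcc_comm], fun x hx => ?_, neg y₁ _ (Or.inl rfl) e1,
      Or.inr (Or.inl rfl), e0⟩
    have := hr x (by rwa [uIcc_comm])
    simp [InRange, h]
    exact this
  · obtain ⟨y₀, y₁, hsub, e0, e1, hr⟩ := exists_crossing hcont o5.le
      (x₀ := x₀) (x₁ := x₁) (by linarith) (by linarith)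
    refine ⟨y₀, y₁, R, hsub, fun x hx => ?_, neg y₀ _ (Or.inr rfl) e0,
      Or.inr (Or.inr rfl), e1⟩
    have := hr x hx
    simp [InRange, h]
    exact this

theorem Stretched.succ (hgrid : BlockGrid z W N N' A T e e' c w d)
    (hlev : Levels G A T e e' c w d r₀ r₁ ρ₁ ρ₂ R) {S : ℕ → Fin 3} {n : ℕ} {x₀ x₁ : ℝ}
    (hs : Stretched z W G N r₀ r₁ ρ₁ ρ₂ R S n x₀ x₁) :
    ∃ y₀ y₁, Stretched z W G N r₀ r₁ ρ₁ ρ₂ R S (n + 1) y₀ y₁ := by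
  obtain ⟨y₀, y₁, L, hsub, hrange, ⟨k₀, hk₀, hneg⟩, hL, hML⟩ := hs.exists_subsegment hgrid hlev
  have o1 := hlev.r₀_pos
  have o2 := hlev.r₀_lt
  have o3 := hlev.r₁_lt
  have o4 := hlev.ρ₁_lt
  have o5 := hlev.ρ₂_lt
  have hN := hgrid.two_mul_le
  have hE : 2 * N * (n + 1) = 2 * N * n + 2 * N := by ring
  obtain ⟨hpos, hlarge⟩ := expelled_of_blockMax hgrid hlev (isDiscreteSol_shoot z W G y₁)
    (hs.nonneg y₁ (hsub right_mem_uIcc) _ le_rfl) (hs.entry y₁ (hsub right_mem_uIcc)) hL hML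
  have hne : (Finset.range (2 * N * (n + 1) + 1)).Nonempty := Finset.nonempty_range_add_one
  obtain ⟨y, hy, hy0, hynn⟩ := exists_last_zero
    (f := fun x => (Finset.range (2 * N * (n + 1) + 1)).inf' hne fun k => (shoot z W G x k).1)
    (Continuous.finset_inf'_apply _ fun _ _ =>
      continuous_fst.comp (continuous_shoot z W hlev.cont _))
    (x₀ := y₀) (x₁ := y₁)
    ((Finset.inf'_le _ (Finset.mem_range.2 (by omega : k₀ < _))).trans hneg)
    ((Finset.le_inf'_iff _ _).2 fun k hk => by
      rw [Finset.mem_range] at hk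
      rcases le_total (2 * N * n) k with h | h
      · exact hpos k h (by omega)
      · exact hs.nonneg y₁ (hsub right_mem_uIcc) k h)
  have hsub' : uIcc y y₁ ⊆ uIcc y₀ y₁ := uIcc_subset_uIcc_right hy
  have hnn : ∀ x ∈ uIcc y y₁, ∀ k ≤ 2 * N * (n + 1), 0 ≤ (shoot z W G x k).1 := by
    intro x hx k hk
    exact (Finset.le_inf'_iff _ _).1 (hynn x hx) k (Finset.mem_range.2 (by omega))
  refine ⟨y, y₁, hnn, ?_, ?_, ?_, hlarge⟩
  · intro x hx j hj
    rcases (Nat.lt_succ_iff.1 hj).eq_or_lt with rfl | hlt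
    · exact hrange x (hsub' hx)
    · exact hs.range x (hsub (hsub' hx)) j hlt
  · intro x hx hr _
    obtain ⟨γ, hγ, hbig, hGγ⟩ := hlev.large_neg
    have hMR : blockMax N (fun k => (shoot z W G x k).1) n ≤ R :=
      (hrange x (hsub' hx)).le (by linarith) (by linarith)
    exact (isDiscreteSol_shoot z W G x).entry hgrid.mono hlev.nonneg (m₀ := 2 * N * n + N)
      (m₁ := 2 * N * n + N + N') (m₂ := 2 * N * n + N + (N - N')) (by omega) (by omega) (by omega)
      (hgrid.weight_nonpos n) hγ (by linarith) (fun k _ hk => hnn x hx k hk)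
      ((le_blockMax (fun k => (shoot z W G x k).1) (by omega) le_rfl).trans hMR) hr
      (fun s hs hs' => hGγ s (by linarith) hs') (hgrid.left_neg n) (hgrid.sum_mid_neg n) hbig
  · obtain ⟨k, hk, hk0⟩ := Finset.exists_mem_eq_inf' hne fun k => (shoot z W G y k).1
    rw [Finset.mem_range] at hk
    exact (isDiscreteSol_shoot z W G y).end_of_zero hgrid.mono hlev.map_zero rfl
      (hnn y left_mem_uIcc) (by omega : k ≤ _) (hk0.symm.trans hy0)

/-- Nonnegative discrete solutions realizing any finite number of symbols. -/
theorem exists_discreteSol (hgrid : BlockGrid z W N N' A T e e' c w d)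
    (hlev : Levels G A T e e' c w d r₀ r₁ ρ₁ ρ₂ R) (S : ℕ → Fin 3) (n : ℕ) :
    ∃ u v, IsDiscreteSol z W G u v ∧ (∀ k ≤ 2 * N * n, 0 ≤ u k) ∧
      ∀ j < n, InRange r₀ r₁ ρ₁ ρ₂ R (S j) (blockMax N u j) := by
  suffices h : ∃ x₀ x₁, Stretched z W G N r₀ r₁ ρ₁ ρ₂ R S n x₀ x₁ by
    obtain ⟨x₀, x₁, hs⟩ := h
    exact ⟨_, _, isDiscreteSol_shoot z W G x₀, hs.nonneg x₀ left_mem_uIcc,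
      hs.range x₀ left_mem_uIcc⟩
  induction n with
  | zero =>
    have hR : 0 ≤ R := by
      linarith [hlev.r₀_pos, hlev.r₀_lt, hlev.r₁_lt, hlev.ρ₁_lt, hlev.ρ₂_lt]
    refine ⟨0, R, ?_, by simp, ?_, ?_, ?_⟩
    · intro x hx k hk
      obtain rfl : k = 0 := by simpa using hk
      rw [uIcc_of_le hR] at hx
      exact hx.1
    · intro x _ _ _
      simp [shoot]
    · simp [shoot]
    · simp [shoot]
  | succ n ih =>
    obtain ⟨x₀, x₁, hs⟩ := ih
    exact hs.succ hgrid hlev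

end Finite

open Classical in
/-- The largest index `k ≤ n` with `z k ≤ t`. -/
noncomputable def gridIndex (z : ℕ → ℝ) (n : ℕ) (t : ℝ) : ℕ :=
  Nat.findGreatest (fun k => z k ≤ t) n

section GridIndex

variable {z : ℕ → ℝ} {n : ℕ} {t : ℝ}

theorem gridIndex_le : gridIndex z n t ≤ n := Nat.findGreatest_le n

theorem le_of_gridIndex (h : z 0 ≤ t) : z (gridIndex z n t) ≤ t := by
  classical
  exact Nat.findGreatest_spec (P := fun k => z k ≤ t) (Nat.zero_le n) h

theorem le_gridIndex {k : ℕ} (hk : k ≤ n) (h : z k ≤ t) :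
    k ≤ gridIndex z n t := by
  classical
  exact Nat.le_findGreatest hk h

theorem gridIndex_lt (hz : StrictMono z) (h0 : z 0 ≤ t) (h : t < z n) : gridIndex z n t < n :=
  hz.lt_iff_lt.1 ((le_of_gridIndex h0).trans_lt h)

theorem lt_gridIndex_succ (hz : StrictMono z) (h0 : z 0 ≤ t) (h : t < z n) :
    t < z (gridIndex z n t + 1) := by
  classical
  exact not_le.1 (Nat.findGreatest_is_greatest (P := fun k => z k ≤ t) (Nat.lt_succ_self _)
    (gridIndex_lt hz h0 h))

theorem gridIndex_eq (hz : StrictMono z) {k : ℕ} (hk : k ≤ n) (h0 : z k ≤ t) (h : t < z (k + 1)) :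
    gridIndex z n t = k := by
  classical
  rw [gridIndex, Nat.findGreatest_eq_iff]
  refine ⟨hk, fun _ => h0, fun j hj _ => ?_⟩
  exact not_le.2 (h.trans_le (hz.monotone hj))

theorem gridIndex_mono (z : ℕ → ℝ) (n : ℕ) : Monotone (gridIndex z n) := by
  classical
  intro s t hst
  exact Nat.findGreatest_mono_left (fun k hk => hk.trans hst) n

theorem measurable_comp_gridIndex (z : ℕ → ℝ) (n : ℕ) (x : ℕ → ℝ) :
    Measurable fun t => x (gridIndex z n t) :=
  (measurable_from_nat (f := x)).comp (gridIndex_mono z n).measurable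

end GridIndex

/-- A family of grids whose mesh tends to zero and which exhaust the real line. -/
structure ExhaustingGrids (z : ℕ → ℕ → ℝ) (n : ℕ → ℕ) (ε : ℕ → ℝ) : Prop where
  mono : ∀ i, StrictMono (z i)
  mesh : ∀ i k, z i (k + 1) - z i k ≤ ε i
  mesh_zero : Tendsto ε atTop (𝓝 0)
  bot : Tendsto (fun i => z i 0) atTop atBot
  top : Tendsto (fun i => z i (n i)) atTop atTop

namespace ExhaustingGrids

variable {z : ℕ → ℕ → ℝ} {n : ℕ → ℕ} {ε : ℕ → ℝ}

theorem comp (h : ExhaustingGrids z n ε) {φ : ℕ → ℕ} (hφ : Tendsto φ atTop atTop) :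
    ExhaustingGrids (fun i => z (φ i)) (fun i => n (φ i)) (fun i => ε (φ i)) :=
  ⟨fun _ => h.mono _, fun _ => h.mesh _, h.mesh_zero.comp hφ, h.bot.comp hφ, h.top.comp hφ⟩

theorem eventually_mem (h : ExhaustingGrids z n ε) (t : ℝ) :
    ∀ᶠ i in atTop, z i 0 ≤ t ∧ t < z i (n i) :=
  (h.bot.eventually (eventually_le_atBot t)).and (h.top.eventually (eventually_gt_atTop t))

theorem eventually_index (h : ExhaustingGrids z n ε) (t : ℝ) :
    ∀ᶠ i in atTop, gridIndex (z i) (n i) t < n i ∧ z i (gridIndex (z i) (n i) t) ≤ t ∧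
      t - ε i ≤ z i (gridIndex (z i) (n i) t) := by
  filter_upwards [h.eventually_mem t] with i hi
  refine ⟨gridIndex_lt (h.mono i) hi.1 hi.2, le_of_gridIndex hi.1, ?_⟩
  have h1 := lt_gridIndex_succ (h.mono i) hi.1 hi.2
  have h2 := h.mesh i (gridIndex (z i) (n i) t)
  linarith

theorem tendsto_index (h : ExhaustingGrids z n ε) (t : ℝ) :
    Tendsto (fun i => z i (gridIndex (z i) (n i) t)) atTop (𝓝 t) := by
  refine tendsto_of_tendsto_of_tendsto_of_le_of_le' (g := fun i => t - ε i) (h := fun _ => t)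
    ?_ tendsto_const_nhds ?_ ?_
  · simpa using h.mesh_zero.const_sub t
  · filter_upwards [h.eventually_index t] with i hi using hi.2.2
  · filter_upwards [h.eventually_index t] with i hi using hi.2.1

/-- Passage to the limit in step functions whose increments are integrals over the cells. -/
theorem tendsto_primitive (h : ExhaustingGrids z n ε) {x : ℕ → ℕ → ℝ} {f : ℕ → ℝ → ℝ}
    {F b : ℝ → ℝ} {x₀ : ℝ} (hfm : ∀ i, AEStronglyMeasurable (f i) volume)
    (hfb : ∀ i s, |f i s| ≤ b s) (hb : ∀ s t, IntervalIntegrable b volume s t)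
    (hstep : ∀ i, ∀ k < n i, x i (k + 1) - x i k = ∫ s in z i k..z i (k + 1), f i s)
    (hlim : ∀ s, Tendsto (fun i => f i s) atTop (𝓝 (F s)))
    (h0 : Tendsto (fun i => x i (gridIndex (z i) (n i) 0)) atTop (𝓝 x₀)) (t : ℝ) :
    Tendsto (fun i => x i (gridIndex (z i) (n i) t)) atTop (𝓝 (x₀ + ∫ s in 0..t, F s)) := by
  have hfi : ∀ i s t, IntervalIntegrable (f i) volume s t := fun i s t =>
    (hb s t).mono_fun (hfm i).restrict (Eventually.of_forall fun r =>
      (hfb i r).trans (le_abs_self _))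
  have htel : ∀ i, ∀ j k : ℕ, j ≤ k → k ≤ n i → x i k - x i j = ∫ s in z i j..z i k, f i s := by
    intro i j k hjk
    induction k, hjk using Nat.le_induction with
    | base => simp
    | succ k hk ih =>
      intro hkn
      rw [← intervalIntegral.integral_add_adjacent_intervals (hfi i _ (z i k)) (hfi i _ _),
        ← ih (by omega), ← hstep i k (by omega)]
      ring
  have htel' : ∀ i, ∀ j k : ℕ, j ≤ n i → k ≤ n i → x i k - x i j = ∫ s in z i j..z i k, f i s := by
    intro i j k hj hk
    rcases le_total j k with hjk | hjk
    · exact htel i j k hjk hk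
    · rw [intervalIntegral.integral_symm, ← htel i k j hjk hj]; ring
  have hmain : Tendsto (fun i => ∫ s in 0..t, f i s) atTop (𝓝 (∫ s in 0..t, F s)) := by
    refine intervalIntegral.tendsto_integral_filter_of_dominated_convergence b
      (Eventually.of_forall fun i => (hfm i).restrict)
      (Eventually.of_forall fun i => Eventually.of_forall fun s _ => hfb i s) (hb 0 t)
      (Eventually.of_forall fun s _ => hlim s)
  have herr : ∀ t, Tendsto (fun i => ∫ s in z i (gridIndex (z i) (n i) t)..t, f i s)
      atTop (𝓝 0) := by
    intro t
    have hcont : Continuous fun y => ∫ s in y..t, b s := by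
      have := intervalIntegral.continuous_primitive hb t
      refine this.neg.congr fun y => ?_
      exact (intervalIntegral.integral_symm _ _).symm
    have h1 : Tendsto (fun i => |∫ s in z i (gridIndex (z i) (n i) t)..t, b s|) atTop (𝓝 0) := by
      have := (hcont.tendsto t).comp (h.tendsto_index t)
      simpa using this.abs
    refine squeeze_zero_norm (fun i => ?_) h1
    exact intervalIntegral.norm_integral_le_abs_of_norm_le
      (Eventually.of_forall fun s => hfb i s) (hb _ _)
  have heq : ∀ i, x i (gridIndex (z i) (n i) t) = x i (gridIndex (z i) (n i) 0) +
      ((∫ s in 0..t, f i s) + (∫ s in z i (gridIndex (z i) (n i) 0)..0, f i s)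
        - ∫ s in z i (gridIndex (z i) (n i) t)..t, f i s) := by
    intro i
    have e1 := htel' i (gridIndex (z i) (n i) 0) (gridIndex (z i) (n i) t) gridIndex_le gridIndex_le
    have e2 := intervalIntegral.integral_add_adjacent_intervals
      (hfi i (z i (gridIndex (z i) (n i) 0)) 0) (hfi i 0 t)
    have e3 := intervalIntegral.integral_add_adjacent_intervals
      (hfi i (z i (gridIndex (z i) (n i) 0)) (z i (gridIndex (z i) (n i) t)))
      (hfi i (z i (gridIndex (z i) (n i) t)) t)
    linarith
  simp_rw [heq]
  simpa using h0.add ((hmain.add (herr 0)).sub (herr t))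

/-- Bounded discrete solutions on finer and finer grids have a subsequence converging to a solution
on the real line. -/
theorem exists_limit (h : ExhaustingGrids z n ε) {q G : ℝ → ℝ} {u v : ℕ → ℕ → ℝ} {R C Gm : ℝ}
    (hq : LocallyIntegrable q) (hG : Continuous G)
    (hsol : ∀ i, IsDiscreteSol (z i) (fun k => ∫ s in z i k..z i (k + 1), q s) G (u i) (v i))
    (hu : ∀ i, ∀ k ≤ n i, u i k ∈ Icc 0 R) (hv : ∀ i, ∀ k ≤ n i, v i k ∈ Icc (-C) C)
    (hGm : ∀ s ∈ Icc 0 R, |G s| ≤ Gm) :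
    ∃ (φ : ℕ → ℕ) (U V : ℝ → ℝ), StrictMono φ ∧ (∀ t, HasDerivAt U (V t) t) ∧
      (∀ t₀ t, V t = V t₀ - ∫ s in t₀..t, q s * G (U s)) ∧
      ∀ (t : ℝ) (ψ k : ℕ → ℕ), Tendsto ψ atTop atTop → (∀ i, k i ≤ n (φ (ψ i))) →
        Tendsto (fun i => z (φ (ψ i)) (k i)) atTop (𝓝 t) →
        Tendsto (fun i => u (φ (ψ i)) (k i)) atTop (𝓝 (U t)) := by
  have hlip : ∀ i, ∀ j ≤ n i, ∀ k ≤ n i, |u i k - u i j| ≤ C * |z i k - z i j| := by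
    have key : ∀ i, ∀ j k : ℕ, j ≤ k → k ≤ n i → |u i k - u i j| ≤ C * |z i k - z i j| := by
      intro i j k hjk hk
      have hm := (h.mono i).monotone
      have h1 := (hsol i).pos_le hm hjk fun l _ hl => (hv i l (by omega)).2
      have h2 := (hsol i).le_pos hm hjk fun l _ hl => (hv i l (by omega)).1
      rw [abs_of_nonneg (sub_nonneg.2 (hm hjk)), abs_le]
      constructor <;> linarith
    intro i j hj k hk
    rcases le_total j k with hjk | hjk
    · exact key i j k hjk hk
    · rw [abs_sub_comm, abs_sub_comm (z i k)]
      exact key i k j hjk hj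
  obtain ⟨⟨x, y⟩, φ, hφ, hxy⟩ := CompactSpace.tendsto_subseq
    (fun i => ((fun r : ℚ => (⟨u i (gridIndex (z i) (n i) r), hu i _ gridIndex_le⟩ : Icc 0 R)),
      (⟨v i (gridIndex (z i) (n i) 0), hv i _ gridIndex_le⟩ : Icc (-C) C)))
  have hφt := hφ.tendsto_atTop
  have hg := h.comp hφt
  have hrat : ∀ r : ℚ, Tendsto (fun i => u (φ i) (gridIndex (z (φ i)) (n (φ i)) r)) atTop
      (𝓝 (x r : ℝ)) := by
    intro r
    have h1 := (tendsto_pi_nhds.1 ((continuous_fst.tendsto _).comp hxy)) r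
    exact (continuous_subtype_val.tendsto _).comp h1
  have hvel : Tendsto (fun i => v (φ i) (gridIndex (z (φ i)) (n (φ i)) 0)) atTop
      (𝓝 (y : ℝ)) :=
    (continuous_subtype_val.tendsto _).comp ((continuous_snd.tendsto _).comp hxy)
  have hlim : ∀ t, ∃ l, Tendsto (fun i => u (φ i) (gridIndex (z (φ i)) (n (φ i)) t)) atTop
      (𝓝 l) := by
    intro t
    refine cauchySeq_tendsto_of_complete (Metric.cauchySeq_iff.2 fun η hη => ?_)
    obtain ⟨r, hr⟩ : ∃ r : ℚ, C * |t - r| < η / 4 := by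
      have hc : Continuous fun s : ℝ => C * |t - s| := by fun_prop
      have ho : IsOpen {s : ℝ | C * |t - s| < η / 4} := isOpen_lt hc continuous_const
      obtain ⟨r, hr⟩ := Rat.denseRange_cast.exists_mem_open ho ⟨t, by simp; linarith⟩
      exact ⟨r, hr⟩
    have hclose : ∀ᶠ i in atTop, |u (φ i) (gridIndex (z (φ i)) (n (φ i)) t) -
        u (φ i) (gridIndex (z (φ i)) (n (φ i)) r)| < η / 4 := by
      have h1 : Tendsto (fun i => C * |z (φ i) (gridIndex (z (φ i)) (n (φ i)) t) -
          z (φ i) (gridIndex (z (φ i)) (n (φ i)) r)|) atTop (𝓝 (C * |t - r|)) :=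
        (((hg.tendsto_index t).sub (hg.tendsto_index r)).abs).const_mul C
      filter_upwards [h1.eventually_lt_const hr] with i hi
      exact (hlip _ _ gridIndex_le _ gridIndex_le).trans_lt hi
    obtain ⟨N₁, hN₁⟩ := eventually_atTop.1 hclose
    obtain ⟨N₂, hN₂⟩ := Metric.cauchySeq_iff.1 (hrat r).cauchySeq (η / 4) (by linarith)
    refine ⟨max N₁ N₂, fun i hi j hj => ?_⟩
    have a1 := abs_lt.1 (hN₁ i (le_of_max_le_left hi))
    have a2 := abs_lt.1 (hN₁ j (le_of_max_le_left hj))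
    have a3 := hN₂ i (le_of_max_le_right hi) j (le_of_max_le_right hj)
    rw [Real.dist_eq] at a3 ⊢
    have a3 := abs_lt.1 a3
    rw [abs_lt]
    constructor <;> linarith
  choose U hU using hlim
  have hq' : ∀ s t, IntervalIntegrable q volume s t := fun s t => 
    (hq.integrableOn_isCompact isCompact_uIcc).intervalIntegrable
  have hU_range : ∀ t, U t ∈ Icc 0 R := fun t =>
    isClosed_Icc.mem_of_tendsto (hU t) (Eventually.of_forall fun i => hu _ _ gridIndex_le)
  have hU_next : ∀ t, Tendsto (fun i => u (φ i) (min (gridIndex (z (φ i)) (n (φ i)) t + 1)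
      (n (φ i)))) atTop (𝓝 (U t)) := by
    intro t
    have h1 : Tendsto (fun i => u (φ i) (min (gridIndex (z (φ i)) (n (φ i)) t + 1) (n (φ i))) -
        u (φ i) (gridIndex (z (φ i)) (n (φ i)) t)) atTop (𝓝 0) := by
      refine squeeze_zero_norm' (a := fun i => C * ε (φ i)) ?_ ?_
      · filter_upwards [hg.eventually_index t] with i hi
        refine (hlip _ _ gridIndex_le _ (min_le_right _ _)).trans ?_
        have hC : 0 ≤ C := by
          have := hv 0 0 (Nat.zero_le _)
          linarith [this.1, this.2]
        rw [min_eq_left (by omega)]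
        refine mul_le_mul_of_nonneg_left ?_ hC
        rw [abs_of_nonneg (sub_nonneg.2 ((h.mono _).monotone (Nat.le_succ _)))]
        exact h.mesh _ _
      · simpa using (hg.mesh_zero.const_mul C)
    simpa using h1.add (hU t)
  set V : ℝ → ℝ := fun t => y + ∫ s in 0..t, -(q s * G (U s)) with hV
  have hV_lim : ∀ t, Tendsto (fun i => v (φ i) (gridIndex (z (φ i)) (n (φ i)) t)) atTop
      (𝓝 (V t)) := by
    refine hg.tendsto_primitive (x := fun i => v (φ i)) (b := fun s => |q s| * Gm)
      (f := fun i s => -(q s * G (u (φ i) (min (gridIndex (z (φ i)) (n (φ i)) s + 1) (n (φ i))))))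
      ?_ ?_ ?_ ?_ ?_ hvel
    · intro i
      refine (hq.aestronglyMeasurable.mul ?_).neg
      exact (measurable_comp_gridIndex _ _ fun k => G (u (φ i) (min (k + 1)
        (n (φ i))))).aestronglyMeasurable
    · intro i s
      rw [abs_neg, abs_mul]
      exact mul_le_mul_of_nonneg_left (hGm _ (hu _ _ (min_le_right _ _))) (abs_nonneg _)
    · intro s t
      exact (hq' s t).abs.mul_const Gm
    · intro i k hk
      rw [(hsol (φ i)).vel_step, sub_sub_cancel_left, ← intervalIntegral.integral_mul_const,
        ← intervalIntegral.integral_neg]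
      have hlt := h.mono (φ i) k.lt_succ_self
      refine intervalIntegral.integral_congr_ae ?_
      have hne : ∀ᵐ s : ℝ, s ≠ z (φ i) (k + 1) := by
        simp [ae_iff]
      filter_upwards [hne] with s hs hmem
      rw [uIoc_of_le hlt.le] at hmem
      rw [gridIndex_eq (h.mono _) hk.le hmem.1.le (lt_of_le_of_ne hmem.2 hs),
        min_eq_left (by omega)]
    · intro s
      exact (((hG.tendsto _).comp (hU_next s)).const_mul (q s)).neg
  have hU_eq : ∀ t, U t = U 0 + ∫ s in 0..t, V s := by
    intro t
    refine tendsto_nhds_unique (hU t) ?_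
    refine hg.tendsto_primitive (x := fun i => u (φ i)) (b := fun _ => C)
      (f := fun i s => v (φ i) (gridIndex (z (φ i)) (n (φ i)) s)) ?_ ?_ ?_ ?_ hV_lim (hU 0) t
    · exact fun i => (measurable_comp_gridIndex _ _ (v (φ i))).aestronglyMeasurable
    · exact fun i s => abs_le.2 (hv _ _ gridIndex_le)
    · exact fun s t => intervalIntegrable_const
    · intro i k hk
      have hlt := h.mono (φ i) k.lt_succ_self
      have e1 : ∫ s in z (φ i) k..z (φ i) (k + 1), v (φ i) (gridIndex (z (φ i)) (n (φ i)) s) =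
          ∫ s in z (φ i) k..z (φ i) (k + 1), v (φ i) k := by
        refine intervalIntegral.integral_congr_ae ?_
        have hne : ∀ᵐ s : ℝ, s ≠ z (φ i) (k + 1) := by
          simp [ae_iff]
        filter_upwards [hne] with s hs hmem
        rw [uIoc_of_le hlt.le] at hmem
        rw [gridIndex_eq (h.mono _) hk.le hmem.1.le (lt_of_le_of_ne hmem.2 hs)]
      rw [e1, intervalIntegral.integral_const, (hsol (φ i)).pos_step, smul_eq_mul]
      ring
  have hUm : Measurable U := measurable_of_tendsto_metrizable
    (fun i => measurable_comp_gridIndex (z (φ i)) (n (φ i)) (u (φ i))) (tendsto_pi_nhds.2 hU)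
  have hqGU : ∀ s t, IntervalIntegrable (fun s => q s * G (U s)) volume s t := by
    intro s t
    refine ((hq' s t).abs.mul_const Gm).mono_fun
      (hq.aestronglyMeasurable.mul (hG.measurable.comp hUm).aestronglyMeasurable).restrict
      (Eventually.of_forall fun r => ?_)
    simp only [norm_mul, Real.norm_eq_abs, abs_abs]
    exact mul_le_mul_of_nonneg_left ((hGm _ (hU_range r)).trans (le_abs_self _)) (abs_nonneg _)
  have hVc : Continuous V :=
    continuous_const.add (intervalIntegral.continuous_primitive (fun s t => (hqGU s t).neg) 0)
  refine ⟨φ, U, V, hφ, ?_, ?_, ?_⟩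
  · intro t
    have h1 : HasDerivAt (fun t => U 0 + ∫ s in 0..t, V s) (V t) t :=
      (intervalIntegral.integral_hasDerivAt_right (hVc.intervalIntegrable _ _)
        (hVc.stronglyMeasurableAtFilter _ _) hVc.continuousAt).const_add _
    rwa [← funext hU_eq] at h1
  · intro t₀ t
    have h1 := intervalIntegral.integral_add_adjacent_intervals (hqGU 0 t₀) (hqGU t₀ t)
    simp only [hV, intervalIntegral.integral_neg]
    linarith
  · intro t ψ k hψ hk hz
    have h1 : Tendsto (fun i => u (φ (ψ i)) (k i) -
        u (φ (ψ i)) (gridIndex (z (φ (ψ i))) (n (φ (ψ i))) t)) atTop (𝓝 0) := by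
      refine squeeze_zero_norm (fun i => hlip _ _ gridIndex_le _ (hk i)) ?_
      have := ((hz.sub ((hg.tendsto_index t).comp hψ)).abs).const_mul C
      simpa using this
    simpa using h1.add ((hU t).comp hψ)

end ExhaustingGrids

/-- Offset of the `i`-th grid point inside a block made of `N` cells covering a length `A` and `N`
cells covering a length `B`. -/
noncomputable def gridOffset (A B : ℝ) (N i : ℕ) : ℝ :=
  if i ≤ N then i * A / N else A + (i - N) * B / N

/-- The grid with `2 * N` cells per period `A + B` starting at `x`. -/
noncomputable def gridPt (x A B : ℝ) (N k : ℕ) : ℝ :=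
  x + (k / (2 * N) : ℕ) * (A + B) + gridOffset A B N (k % (2 * N))

section Grid

variable {x A B : ℝ} {N : ℕ}

theorem gridOffset_of_le {i : ℕ} (h : i ≤ N) : gridOffset A B N i = i * A / N := if_pos h

theorem gridOffset_of_ge (hN : 0 < N) {i : ℕ} (h : N ≤ i) :
    gridOffset A B N i = A + (i - N) * B / N := by
  rcases h.eq_or_lt with rfl | h
  · rw [gridOffset_of_le le_rfl]
    field_simp
    ring
  · exact if_neg (by omega)

theorem gridPt_add (hN : 0 < N) (n : ℕ) {i : ℕ} (hi : i ≤ 2 * N) :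
    gridPt x A B N (2 * N * n + i) = x + n * (A + B) + gridOffset A B N i := by
  rcases hi.eq_or_lt with rfl | hi
  · have e : 2 * N * n + 2 * N = 2 * N * (n + 1) := by ring
    rw [gridPt, e, Nat.mul_div_cancel_left _ (by omega), Nat.mul_mod_right,
      gridOffset_of_le (Nat.zero_le _), gridOffset_of_ge hN (by omega)]
    push_cast
    field_simp
    ring
  · rw [gridPt, Nat.mul_add_div (by omega), Nat.div_eq_of_lt hi, Nat.mul_add_mod,
      Nat.mod_eq_of_lt hi, add_zero]

theorem gridOffset_succ_sub (hN : 0 < N) (i : ℕ) :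
    gridOffset A B N (i + 1) - gridOffset A B N i = if i < N then A / N else B / N := by
  split_ifs with h
  · rw [gridOffset_of_le h, gridOffset_of_le h.le]
    push_cast
    ring
  · rw [gridOffset_of_ge hN (by omega), gridOffset_of_ge hN (by omega)]
    push_cast
    ring

theorem gridPt_succ_sub (hN : 0 < N) (k : ℕ) :
    gridPt x A B N (k + 1) - gridPt x A B N k = if k % (2 * N) < N then A / N else B / N := by
  have hlt := Nat.mod_lt k (show 2 * N > 0 by omega)
  have e := Nat.div_add_mod k (2 * N)
  have h1 := gridPt_add (x := x) (A := A) (B := B) hN (k / (2 * N)) hlt.le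
  have h2 := gridPt_add (x := x) (A := A) (B := B) hN (k / (2 * N)) (i := k % (2 * N) + 1) hlt
  rw [e] at h1
  rw [← add_assoc, e] at h2
  rw [h1, h2, ← gridOffset_succ_sub hN]
  ring

theorem strictMono_gridPt (hA : 0 < A) (hB : 0 < B) (hN : 0 < N) :
    StrictMono (gridPt x A B N) := by
  refine strictMono_nat_of_lt_succ fun k => sub_pos.1 ?_
  rw [gridPt_succ_sub hN]
  have : (0 : ℝ) < N := by exact_mod_cast hN
  split_ifs <;> positivity

theorem gridPt_mesh (hA : 0 < A) (hB : 0 < B) (hN : 0 < N) (k : ℕ) :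
    gridPt x A B N (k + 1) - gridPt x A B N k ≤ (A + B) / N := by
  rw [gridPt_succ_sub hN]
  have : (0 : ℝ) < N := by exact_mod_cast hN
  split_ifs
  · gcongr; linarith
  · gcongr; linarith

theorem gridOffset_mono (hA : 0 < A) (hB : 0 < B) (hN : 0 < N) : Monotone (gridOffset A B N) := by
  refine monotone_nat_of_le_succ fun i => sub_nonneg.1 ?_
  rw [gridOffset_succ_sub hN]
  have : (0 : ℝ) < N := by exact_mod_cast hN
  split_ifs <;> positivity

end Grid

theorem sum_cell_integral {q : ℝ → ℝ} (hq : LocallyIntegrable q) (z : ℕ → ℝ) {i j : ℕ}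
    (hij : i ≤ j) :
    ∑ k ∈ Finset.Ico i j, ∫ s in z k..z (k + 1), q s = ∫ s in z i..z j, q s :=
  intervalIntegral.sum_integral_adjacent_intervals_Ico hij fun _ _ =>
    (hq.integrableOn_isCompact isCompact_uIcc).intervalIntegrable

theorem blockGrid_gridPt {q a : ℝ → ℝ} {α A B lam mu : ℝ} (hA : 0 < A) (hB : 0 < B)
    (hlam : 0 < lam) (hmu : 0 < mu) (hq : LocallyIntegrable q)
    (hqpos : ∀ (m : ℤ) (x y : ℝ), α ≤ x → x ≤ y → y ≤ α + A →
      ∫ s in (x + m * (A + B))..(y + m * (A + B)), q s = lam * ∫ s in x..y, a s)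
    (hqneg : ∀ (m : ℤ) (x y : ℝ), α + A ≤ x → x ≤ y → y ≤ α + A + B →
      ∫ s in (x + m * (A + B))..(y + m * (A + B)), q s = mu * ∫ s in x..y, a s)
    (hapos : ∀ x y, α ≤ x → x ≤ y → y ≤ α + A → 0 ≤ ∫ s in x..y, a s)
    (haneg : ∀ x y, α + A ≤ x → x ≤ y → y ≤ α + A + B → ∫ s in x..y, a s ≤ 0)
    {K N' : ℕ} (hK : 2 ≤ K) (hN' : 0 < N') (J : ℤ) :
    BlockGrid (gridPt (α + J * (A + B)) A B (K * N'))
      (fun k => ∫ s in gridPt (α + J * (A + B)) A B (K * N') k..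
        gridPt (α + J * (A + B)) A B (K * N') (k + 1), q s)
      (K * N') N' A (A + B) (A / K) (B / K)
      (lam * ∫ s in (α + A / K)..(α + A - A / K), a s) (lam * ∫ s in α..(α + A), a s)
      (mu * -∫ s in (α + A + B / K)..(α + A + B - B / K), a s) := by
  set N := K * N' with hNdef
  have h2N : 2 * N' ≤ N := Nat.mul_le_mul_right _ hK
  have hN : 0 < N := by omega
  have hNr : (N : ℝ) = K * N' := by rw [hNdef]; push_cast; ring
  have hK0 : (0 : ℝ) < K := by exact_mod_cast (show 0 < K by omega)
  have hN'0 : (0 : ℝ) < N' := by exact_mod_cast hN'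
  have hpt : ∀ n i : ℕ, i ≤ 2 * N → gridPt (α + J * (A + B)) A B N (2 * N * n + i) =
      (α + gridOffset A B N i) + ((J + n : ℤ) : ℝ) * (A + B) := by
    intro n i hi
    rw [gridPt_add hN n hi]
    push_cast
    ring
  have hmono := strictMono_gridPt (x := α + J * (A + B)) hA hB hN
  have hoff := gridOffset_mono hA hB hN
  have o0 : gridOffset A B N 0 = 0 := by rw [gridOffset_of_le (by omega)]; simp
  have o1 : gridOffset A B N N' = A / K := by
    rw [gridOffset_of_le (by omega), hNr]; field_simp
  have o2 : gridOffset A B N (N - N') = A - A / K := by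
    rw [gridOffset_of_le (by omega), Nat.cast_sub (by omega), hNr]; field_simp
  have o3 : gridOffset A B N N = A := by
    rw [gridOffset_of_le le_rfl]; field_simp
  have o4 : gridOffset A B N (N + N') = A + B / K := by
    rw [gridOffset_of_ge hN (by omega)]; push_cast; rw [hNr]; field_simp; ring
  have o5 : gridOffset A B N (N + (N - N')) = A + (B - B / K) := by
    rw [gridOffset_of_ge hN (by omega)]; push_cast [Nat.cast_sub (show N' ≤ N by omega)]
    rw [hNr]; field_simp; ring
  have o6 : gridOffset A B N (2 * N) = A + B := by
    rw [gridOffset_of_ge hN (by omega)]; push_cast; field_simp; ring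
  have p0 : ∀ n : ℕ, gridPt (α + J * (A + B)) A B N (2 * N * n) =
      α + ((J + n : ℤ) : ℝ) * (A + B) := fun n => by
    have := hpt n 0 (by omega)
    rwa [o0, add_zero, add_zero] at this
  have p6 : ∀ n : ℕ, gridPt (α + J * (A + B)) A B N (2 * N * (n + 1)) =
      (α + (A + B)) + ((J + n : ℤ) : ℝ) * (A + B) := fun n => by
    have := hpt n (2 * N) le_rfl
    rwa [o6, show 2 * N * n + 2 * N = 2 * N * (n + 1) by ring] at this
  have p4 : ∀ n : ℕ, gridPt (α + J * (A + B)) A B N (2 * N * n + N + N') =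
      (α + (A + B / K)) + ((J + n : ℤ) : ℝ) * (A + B) := fun n => by
    rw [add_assoc, hpt n _ (by omega), o4]
  have p5 : ∀ n : ℕ, gridPt (α + J * (A + B)) A B N (2 * N * n + N + (N - N')) =
      (α + (A + (B - B / K))) + ((J + n : ℤ) : ℝ) * (A + B) := fun n => by
    rw [add_assoc, hpt n _ (by omega), o5]
  have hAK : A / K ≤ A / 2 := by
    gcongr
    exact_mod_cast hK
  have hBK : B / K ≤ B / 2 := by
    gcongr
    exact_mod_cast hK
  have hAK0 : 0 < A / K := by positivity
  have hBK0 : 0 < B / K := by positivity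
  refine ⟨hmono, h2N, ?_, ?_, ?_, ?_, ?_, ?_, ?_, ?_, ?_, ?_, ?_⟩
  · intro n k hk hk'
    obtain ⟨i, rfl⟩ := Nat.exists_eq_add_of_le hk
    have hi : i + 1 ≤ N := by omega
    have b1 : 0 ≤ gridOffset A B N i := o0 ▸ hoff (Nat.zero_le i)
    have b2 := hoff (Nat.le_succ i)
    have b3 : gridOffset A B N (i + 1) ≤ A := by
      have := hoff hi
      rwa [o3] at this
    simp only [Nat.succ_eq_add_one] at b2
    rw [add_assoc, hpt n i (by omega), hpt n (i + 1) (by omega),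
      hqpos _ _ _ (by linarith) (by linarith) (by linarith)]
    exact mul_nonneg hlam.le (hapos _ _ (by linarith) (by linarith) (by linarith))
  · intro n k hk hk'
    obtain ⟨i, rfl⟩ := Nat.exists_eq_add_of_le (show 2 * N * n ≤ k by omega)
    have hE : 2 * N * (n + 1) = 2 * N * n + 2 * N := by ring
    have hi : i + 1 ≤ 2 * N := by omega
    have b1 : A ≤ gridOffset A B N i := by
      have := hoff (show N ≤ i by omega)
      rwa [o3] at this
    have b2 := hoff (Nat.le_succ i)
    have b3 : gridOffset A B N (i + 1) ≤ A + B := o6 ▸ hoff hi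
    simp only [Nat.succ_eq_add_one] at b2
    rw [add_assoc, hpt n i (by omega), hpt n (i + 1) (by omega),
      hqneg _ _ _ (by linarith) (by linarith) (by linarith)]
    exact mul_nonpos_of_nonneg_of_nonpos hmu.le
      (haneg _ _ (by linarith) (by linarith) (by linarith))
  · intro n
    rw [hpt n N' (by omega), p0, o1]
    ring
  · intro n
    rw [hpt n N (by omega), hpt n _ (by omega), o3, o2]
    ring
  · intro n
    rw [hpt n N (by omega), p0, o3]
    ring
  · intro n
    rw [p4, hpt n N (by omega), o3]
    ring
  · intro n
    rw [p6, p5]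
    ring
  · intro n
    rw [p6, p0]
    ring
  · intro n
    rw [sum_cell_integral hq _ (by omega), hpt n N' (by omega), hpt n _ (by omega), o1, o2,
      hqpos _ _ _ (by linarith) (by linarith) (by linarith), add_sub_assoc]
  · intro n
    rw [sum_cell_integral hq _ (by omega), p0, hpt n N (by omega), o3,
      hqpos _ _ _ (by linarith) (by linarith) (by linarith)]
  · intro n
    rw [Finset.sum_neg_distrib, sum_cell_integral hq _ (by omega), p4, p5,
      hqneg _ _ _ (by linarith) (by linarith) (by linarith), ← mul_neg]
    rw [show α + (A + B / K) = α + A + B / K by ring,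
      show α + (A + (B - B / K)) = α + A + B - B / K by ring]

/-- Uniform bounds for nonnegative discrete solutions whose block maxima are at most `R`. -/
theorem IsDiscreteSol.bounds {z W u v : ℕ → ℝ} {G : ℝ → ℝ} {N N' : ℕ}
    {A T e e' c w d R Gm Q : ℝ} (hgrid : BlockGrid z W N N' A T e e' c w d)
    (h : IsDiscreteSol z W G u v) (hN : 0 < N) (hA : 0 < A) (hG : ∀ s, 0 ≤ G s)
    (hGm : ∀ s ∈ Icc 0 R, G s ≤ Gm) (hGm0 : 0 ≤ Gm)
    (hQ : ∀ j, ∑ k ∈ Finset.Ico (2 * N * j) (2 * N * (j + 1)), |W k| ≤ Q) {n : ℕ}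
    (hu : ∀ k ≤ 2 * N * (n + 1), 0 ≤ u k) (hM : ∀ j < n + 1, blockMax N u j ≤ R) :
    ∀ k ≤ 2 * N * n + N, u k ∈ Icc 0 R ∧
      (k < 2 * N * n → v k ∈ Icc (-(R / A + Gm * Q)) (R / A + Gm * Q)) := by
  have hE : ∀ j, 2 * N * (j + 1) = 2 * N * j + 2 * N := fun j => by ring
  have hEle : ∀ {i j}, i ≤ j → 2 * N * i ≤ 2 * N * j := fun hij => Nat.mul_le_mul_left _ hij
  have hblock : ∀ j k, 2 * N * j ≤ k → k ≤ 2 * N * j + N → j ≤ n → u k ≤ R := fun j k h1 h2 hj =>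
    (le_blockMax u h1 h2).trans (hM j (by omega))
  have hpos : ∀ k ≤ 2 * N * n + N, u k ∈ Icc 0 R := by
    intro k hk
    refine ⟨hu k (by have := hE n; omega), ?_⟩
    have h1 := Nat.div_add_mod k (2 * N)
    have h2 := Nat.mod_lt k (show 2 * N > 0 by omega)
    set j := k / (2 * N)
    have hj : j ≤ n := by
      by_contra hlt
      have := hEle (show n + 1 ≤ j by omega)
      have := hE n
      omega
    rcases le_total k (2 * N * j + N) with hkj | hkj
    · exact hblock j k (by omega) hkj hj
    · rcases hkj.eq_or_lt with heq | hlt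
      · exact hblock j k (by omega) heq.ge hj
      have hjn : j < n := by
        rcases hj.eq_or_lt with hh | hh
        · rw [hh] at hlt
          omega
        · exact hh
      have hk2 : k ≤ 2 * N * (j + 1) := by have := hE j; omega
      exact h.le_of_convex hgrid.mono hG (hgrid.weight_nonpos j) hkj hk2
        (hblock j _ (by omega) le_rfl hj) (hblock (j + 1) _ le_rfl (by omega) (by omega))
  intro k hk
  refine ⟨hpos k hk, fun hkn => ?_⟩
  have h1 := Nat.div_add_mod k (2 * N)
  have h2 := Nat.mod_lt k (show 2 * N > 0 by omega)
  set j := k / (2 * N)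
  have hjn : j < n := by
    by_contra hlt
    have := hEle (show n ≤ j by omega)
    omega
  have hjE := hEle (show j + 1 ≤ n by omega)
  have hEj := hE j
  have hvar : ∀ p q, 2 * N * j ≤ p → p ≤ q → q ≤ 2 * N * (j + 1) → |v q - v p| ≤ Gm * Q := by
    intro p q hp hpq hq
    rw [h.vel_eq hpq, sub_sub_cancel_left, abs_neg]
    calc _ ≤ ∑ i ∈ Finset.Ico p q, |W i * G (u (i + 1))| := Finset.abs_sum_le_sum_abs _ _
      _ ≤ ∑ i ∈ Finset.Ico p q, |W i| * Gm := Finset.sum_le_sum fun i hi => by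
          rw [Finset.mem_Ico] at hi
          rw [abs_mul, abs_of_nonneg (hG _)]
          exact mul_le_mul_of_nonneg_left (hGm _ (hpos _ (by omega))) (abs_nonneg _)
      _ = (∑ i ∈ Finset.Ico p q, |W i|) * Gm := (Finset.sum_mul ..).symm
      _ ≤ (∑ i ∈ Finset.Ico (2 * N * j) (2 * N * (j + 1)), |W i|) * Gm := by
          refine mul_le_mul_of_nonneg_right ?_ hGm0
          exact Finset.sum_le_sum_of_subset_of_nonneg (Finset.Ico_subset_Ico hp hq)
            fun _ _ _ => abs_nonneg _
      _ ≤ Q * Gm := mul_le_mul_of_nonneg_right (hQ j) hGm0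
      _ = _ := mul_comm _ _
  have hz := hgrid.mono.monotone
  have u0 := hpos (2 * N * j) (by omega)
  have u1 := hpos (2 * N * j + N) (by omega)
  have hlow : -(R / A) ≤ v (2 * N * j) := by
    have := h.pos_le hz (show 2 * N * j ≤ 2 * N * j + N by omega) fun i hi hi' =>
      h.vel_anti hG (hgrid.weight_nonneg j) le_rfl hi (by omega)
    rw [hgrid.length_pos] at this
    rw [← neg_div, div_le_iff₀ hA]
    linarith [u0.2, u1.1]
  have hup : v (2 * N * j + N) ≤ R / A := by
    have := h.le_pos hz (show 2 * N * j ≤ 2 * N * j + N by omega) fun i hi hi' =>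
      h.vel_anti hG (hgrid.weight_nonneg j) hi hi'.le le_rfl
    rw [hgrid.length_pos] at this
    rw [le_div_iff₀ hA]
    linarith [u0.1, u1.2]
  constructor
  · have := abs_le.1 (hvar (2 * N * j) k le_rfl (by omega) (by omega))
    linarith [this.1]
  · rcases le_total k (2 * N * j + N) with hkj | hkj
    · have := abs_le.1 (hvar k (2 * N * j + N) (by omega) hkj (by omega))
      linarith [this.1]
    · have := abs_le.1 (hvar (2 * N * j + N) k (by omega) hkj (by omega))
      linarith [this.2]

/-- A nonnegative solution of `U'' + q G(U) = 0` with `G` at most linear vanishes identically as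
soon as it vanishes at one point. -/
theorem eq_zero_of_exists_zero {q G U V : ℝ → ℝ} {κ : ℝ} (hq : LocallyIntegrable q)
    (hU : ∀ t, HasDerivAt U (V t) t) (hV : ∀ t₀ t, V t = V t₀ - ∫ s in t₀..t, q s * G (U s))
    (hnn : ∀ t, 0 ≤ U t) (hκ : 0 ≤ κ) (hG : ∀ t, |G (U t)| ≤ κ * U t) {t₀ : ℝ} (h0 : U t₀ = 0) :
    ∀ t, U t = 0 := by
  have hq' : ∀ s t, IntervalIntegrable q volume s t := fun s t =>
    (hq.integrableOn_isCompact isCompact_uIcc).intervalIntegrable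
  have hUc : Continuous U := continuous_iff_continuousAt.2 fun t => (hU t).continuousAt
  have hopen : IsOpen {t | U t = 0} := by
    rw [Metric.isOpen_iff]
    intro t₁ (ht₁ : U t₁ = 0)
    have hV1 : V t₁ = 0 := by
      have hmin : IsLocalMin U t₁ := Eventually.of_forall fun t => ht₁ ▸ hnn t
      exact hmin.hasDerivAt_eq_zero (hU t₁)
    set Q := ∫ s in (t₁ - 1)..(t₁ + 1), |q s| with hQ
    have hQ0 : 0 ≤ Q := intervalIntegral.integral_nonneg (by linarith) fun s _ => abs_nonneg _
    set η := 1 / (2 * (κ * Q) + 1) with hη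
    have hκQ : 0 ≤ κ * Q := by positivity
    have hη0 : 0 < η := by positivity
    have hη1 : η ≤ 1 := by rw [hη, div_le_one (by positivity)]; linarith
    have hηQ : η * (κ * Q) ≤ 1 / 2 := by
      rw [hη, div_mul_eq_mul_div, div_le_div_iff₀ (by positivity) (by positivity)]
      linarith
    obtain ⟨t₂, ht₂, hmax⟩ := (isCompact_Icc (a := t₁ - η) (b := t₁ + η)).exists_isMaxOn
      ⟨t₁, by constructor <;> linarith⟩ hUc.continuousOn
    have hVb : ∀ t ∈ Icc (t₁ - η) (t₁ + η), ‖V t‖ ≤ κ * Q * U t₂ := by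
      intro t ht
      rw [hV t₁ t, hV1, zero_sub, norm_neg]
      have hsub : uIoc t₁ t ⊆ uIoc (t₁ - 1) (t₁ + 1) := by
        rw [uIoc_of_le (show t₁ - 1 ≤ t₁ + 1 by linarith)]
        intro s hs
        rcases le_total t₁ t with hle | hle
        · rw [uIoc_of_le hle] at hs
          exact ⟨by linarith [hs.1], by linarith [hs.2, ht.2]⟩
        · rw [uIoc_of_ge hle] at hs
          exact ⟨by linarith [hs.1, ht.1], by linarith [hs.2]⟩
      have h1 : ‖∫ s in t₁..t, q s * G (U s)‖ ≤ |∫ s in t₁..t, |q s| * (κ * U t₂)| := by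
        refine intervalIntegral.norm_integral_le_abs_of_norm_le ?_ ((hq' _ _).abs.mul_const _)
        refine (ae_restrict_iff' measurableSet_uIoc).2 (Eventually.of_forall fun s hs => ?_)
        rw [norm_mul, Real.norm_eq_abs, Real.norm_eq_abs]
        refine mul_le_mul_of_nonneg_left ((hG s).trans ?_) (abs_nonneg _)
        refine mul_le_mul_of_nonneg_left (hmax ?_) hκ
        rcases le_total t₁ t with hle | hle
        · rw [uIoc_of_le hle] at hs
          exact ⟨by linarith [hs.1], by linarith [hs.2, ht.2]⟩
        · rw [uIoc_of_ge hle] at hs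
          exact ⟨by linarith [hs.1, ht.1], by linarith [hs.2]⟩
      have h2 : |(∫ s in t₁..t, |q s|)| ≤ Q := by
        have := intervalIntegral.abs_integral_mono_interval hsub
          (Eventually.of_forall fun s => abs_nonneg (q s)) (hq' _ _).abs
        rwa [← hQ, abs_of_nonneg hQ0] at this
      refine h1.trans ?_
      rw [intervalIntegral.integral_mul_const, abs_mul,
        abs_of_nonneg (mul_nonneg hκ (hnn t₂))]
      calc _ ≤ Q * (κ * U t₂) := mul_le_mul_of_nonneg_right h2 (mul_nonneg hκ (hnn t₂))
        _ = _ := by ring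
    have hU2 : U t₂ = 0 := by
      have h1 := Convex.norm_image_sub_le_of_norm_hasDerivWithin_le
        (fun t _ => (hU t).hasDerivWithinAt) hVb (convex_Icc _ _)
        (show t₁ ∈ Icc (t₁ - η) (t₁ + η) by constructor <;> linarith) ht₂
      rw [ht₁, sub_zero, Real.norm_eq_abs, Real.norm_eq_abs, abs_of_nonneg (hnn t₂)] at h1
      have h2 : |t₂ - t₁| ≤ η := abs_le.2 ⟨by linarith [ht₂.1], by linarith [ht₂.2]⟩
      have h3 := mul_le_mul_of_nonneg_left h2 (mul_nonneg hκQ (hnn t₂))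
      have h4 := mul_le_mul_of_nonneg_right hηQ (hnn t₂)
      nlinarith [hnn t₂]
    refine ⟨η, hη0, fun t ht => le_antisymm ?_ (hnn t)⟩
    rw [Real.ball_eq_Ioo] at ht
    exact hU2 ▸ hmax ⟨ht.1.le, ht.2.le⟩
  have hclopen : IsClopen {t | U t = 0} := ⟨isClosed_eq hUc continuous_const, hopen⟩
  have := hclopen.eq_univ ⟨t₀, h0⟩
  intro t
  exact (this ▸ mem_univ t : t ∈ {t | U t = 0})

/-- Block maxima pass to the limit, together with the closed conditions they satisfy. -/
theorem ExhaustingGrids.exists_isGreatest {z : ℕ → ℕ → ℝ} {n : ℕ → ℕ} {ε : ℕ → ℝ}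
    (h : ExhaustingGrids z n ε) {u : ℕ → ℕ → ℝ} {U : ℝ → ℝ}
    (hU : ∀ (t : ℝ) (ψ k : ℕ → ℕ), Tendsto ψ atTop atTop → (∀ i, k i ≤ n (ψ i)) →
      Tendsto (fun i => z (ψ i) (k i)) atTop (𝓝 t) →
      Tendsto (fun i => u (ψ i) (k i)) atTop (𝓝 (U t)))
    {x y : ℝ} {P : Set ℝ} (hP : IsClosed P) (i₀ : ℕ)
    (hb : ∀ i, i₀ ≤ i → ∃ k₁ k₂ m, k₂ ≤ n i ∧ z i k₁ = x ∧ z i k₂ = y ∧ k₁ ≤ m ∧ m ≤ k₂ ∧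
      (∀ k, k₁ ≤ k → k ≤ k₂ → u i k ≤ u i m) ∧ u i m ∈ P) :
    ∃ M ∈ P, IsGreatest (U '' Icc x y) M := by
  have hb' := fun i => hb (i + i₀) (by omega)
  choose k₁ k₂ m hk₂ hx hy hkm hmk hmax hmP using hb'
  have hmem : ∀ i, z (i + i₀) (m i) ∈ Icc x y := fun i =>
    ⟨hx i ▸ (h.mono _).monotone (hkm i), hy i ▸ (h.mono _).monotone (hmk i)⟩
  obtain ⟨t₁, ht₁, χ, hχ, hlim⟩ := isCompact_Icc.tendsto_subseq hmem
  have hψ : Tendsto (fun i => χ i + i₀) atTop atTop :=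
    (tendsto_add_atTop_nat i₀).comp hχ.tendsto_atTop
  have hM := hU t₁ (fun i => χ i + i₀) (fun i => m (χ i)) hψ
    (fun i => (hmk _).trans (hk₂ _)) hlim
  refine ⟨U t₁, hP.mem_of_tendsto hM (Eventually.of_forall fun i => hmP _),
    mem_image_of_mem U ht₁, ?_⟩
  rintro _ ⟨t, ht, rfl⟩
  have ht' := hU t (fun i => χ i + i₀)
    (fun i => gridIndex (z (χ i + i₀)) (n (χ i + i₀)) t) hψ (fun i => gridIndex_le)
    ((h.tendsto_index t).comp hψ)
  refine le_of_tendsto_of_tendsto' ht' hM fun i => hmax _ _ ?_ ?_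
  · exact le_gridIndex (((hkm _).trans (hmk _)).trans (hk₂ _)) ((hx _).trans_le ht.1)
  · refine (h.mono _).le_iff_le.1 ((le_of_gridIndex ?_).trans (ht.2.trans_eq (hy (χ i)).symm))
    exact ((h.mono _).monotone (Nat.zero_le _)).trans ((hx (χ i)).trans_le ht.1)

theorem isClosed_inRange (r₀ r₁ ρ₁ ρ₂ R : ℝ) (i : Fin 3) :
    IsClosed {M | InRange r₀ r₁ ρ₁ ρ₂ R i M} := by
  have h0 : IsClosed {M : ℝ | i = 0 → M ≤ r₀} := isClosed_imp isOpen_const isClosed_Iic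
  have h1 : IsClosed {M : ℝ | i = 1 → r₁ ≤ M ∧ M ≤ ρ₁} := isClosed_imp isOpen_const isClosed_Icc
  have h2 : IsClosed {M : ℝ | i = 2 → ρ₂ ≤ M ∧ M ≤ R} := isClosed_imp isOpen_const isClosed_Icc
  exact h0.inter (h1.inter h2)

/-- Solutions on the whole line realizing a two-sided sequence of symbols. -/
theorem exists_solution_inRange {q a G : ℝ → ℝ} {α A B lam mu r₀ r₁ ρ₁ ρ₂ R Q : ℝ} (hA : 0 < A)
    (hB : 0 < B) (hlam : 0 < lam) (hmu : 0 < mu) (hq : LocallyIntegrable q)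
    (hqpos : ∀ (m : ℤ) (x y : ℝ), α ≤ x → x ≤ y → y ≤ α + A →
      ∫ s in (x + m * (A + B))..(y + m * (A + B)), q s = lam * ∫ s in x..y, a s)
    (hqneg : ∀ (m : ℤ) (x y : ℝ), α + A ≤ x → x ≤ y → y ≤ α + A + B →
      ∫ s in (x + m * (A + B))..(y + m * (A + B)), q s = mu * ∫ s in x..y, a s)
    (hapos : ∀ x y, α ≤ x → x ≤ y → y ≤ α + A → 0 ≤ ∫ s in x..y, a s)
    (haneg : ∀ x y, α + A ≤ x → x ≤ y → y ≤ α + A + B → ∫ s in x..y, a s ≤ 0)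
    (hQ : ∀ x, ∫ s in x..(x + (A + B)), |q s| ≤ Q) {K : ℕ} (hK : 2 ≤ K)
    (hlev : Levels G A (A + B) (A / K) (B / K)
      (lam * ∫ s in (α + A / K)..(α + A - A / K), a s) (lam * ∫ s in α..(α + A), a s)
      (mu * -∫ s in (α + A + B / K)..(α + A + B - B / K), a s) r₀ r₁ ρ₁ ρ₂ R) (S : ℤ → Fin 3) :
    ∃ U V : ℝ → ℝ, (∀ t, HasDerivAt U (V t) t) ∧
      (∀ t₀ t, V t = V t₀ - ∫ s in t₀..t, q s * G (U s)) ∧ (∀ t, U t ∈ Icc 0 R) ∧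
      ∀ j : ℤ, ∃ M, InRange r₀ r₁ ρ₁ ρ₂ R (S j) M ∧
        IsGreatest (U '' Icc (α + j * (A + B)) (α + A + j * (A + B))) M := by
  have hT : 0 < A + B := by linarith
  set N : ℕ → ℕ := fun i => K * (i + 1) with hNdef
  have hN : ∀ i, i + 1 ≤ N i := fun i => Nat.le_mul_of_pos_left _ (by omega)
  set z : ℕ → ℕ → ℝ := fun i => gridPt (α + ((-(i : ℤ) : ℤ) : ℝ) * (A + B)) A B (N i) with hz
  set n : ℕ → ℕ := fun i => 2 * N i * (2 * i + 1) - 1 with hn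
  have hgrid := fun i : ℕ => blockGrid_gridPt hA hB hlam hmu hq hqpos hqneg hapos haneg hK
    i.succ_pos (-(i : ℤ))
  have hstart : ∀ i b, z i (2 * N i * b) = α + (b - i) * (A + B) := fun i b => by
    have := gridPt_add (x := α + ((-(i : ℤ) : ℤ) : ℝ) * (A + B)) (A := A) (B := B)
      (show 0 < N i by have := hN i; omega) b (Nat.zero_le (2 * N i))
    rw [gridOffset_of_le (Nat.zero_le _), add_zero] at this
    rw [hz]
    simp only [this]
    push_cast
    ring
  have hmid : ∀ i b, z i (2 * N i * b + N i) = α + A + (b - i) * (A + B) := fun i b => by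
    have h1 := (hgrid i).length_pos b
    have h2 := hstart i b
    simp only [hz, hNdef] at h1 h2 ⊢
    linarith
  have hE : ExhaustingGrids z n (fun i => (A + B) / N i) := by
    have hmesh : ∀ i k, z i (k + 1) - z i k ≤ (A + B) / N i := fun i k =>
      gridPt_mesh hA hB (by have := hN i; omega) k
    refine ⟨fun i => (hgrid i).mono, hmesh, ?_, ?_, ?_⟩
    · refine Tendsto.const_div_atTop (tendsto_natCast_atTop_atTop.comp ?_) _
      exact tendsto_atTop_mono (fun i => (Nat.le_succ i).trans (hN i)) tendsto_id
    · have : (fun i => z i 0) = fun i : ℕ => α + -((i : ℝ) * (A + B)) := by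
        funext i
        have := hstart i 0
        rw [mul_zero] at this
        rw [this]
        push_cast
        ring
      rw [this]
      exact tendsto_atBot_add_const_left _ _
        (tendsto_neg_atTop_atBot.comp (tendsto_natCast_atTop_atTop.atTop_mul_const hT))
    · have hlow : ∀ i : ℕ, α + i * (A + B) ≤ z i (n i) := by
        intro i
        have h1 := hstart i (2 * i + 1)
        have h2 := hmesh i (n i)
        have hpos : 0 < 2 * N i * (2 * i + 1) := by
          have := hN i
          positivity
        rw [show n i + 1 = 2 * N i * (2 * i + 1) by simp only [hn]; omega, h1] at h2
        have h3 : (A + B) / N i ≤ A + B := by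
          refine div_le_self hT.le ?_
          exact_mod_cast (Nat.le_add_left 1 i).trans (hN i)
        push_cast at h2
        linarith
      exact tendsto_atTop_mono hlow (tendsto_atTop_add_const_left _ _
        (tendsto_natCast_atTop_atTop.atTop_mul_const hT))
  have hsol := fun i : ℕ => exists_discreteSol (hgrid i) hlev (fun b => S (b - i)) (2 * i + 2)
  choose u v huv hnn hrange using hsol
  obtain ⟨Gm, hGm⟩ := (isCompact_Icc (a := (0 : ℝ)) (b := R)).exists_bound_of_continuousOn
    hlev.cont.continuousOn
  have hr : r₀ ≤ R ∧ ρ₁ ≤ R ∧ 0 ≤ R := by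
    refine ⟨?_, ?_, ?_⟩ <;>
    linarith [hlev.r₀_pos, hlev.r₀_lt, hlev.r₁_lt, hlev.ρ₁_lt, hlev.ρ₂_lt]
  have hGm0 : 0 ≤ Gm := (norm_nonneg _).trans (hGm 0 ⟨le_rfl, hr.2.2⟩)
  have hcell : ∀ i b, ∑ k ∈ Finset.Ico (2 * N i * b) (2 * N i * (b + 1)),
      |∫ s in z i k..z i (k + 1), q s| ≤ Q := by
    intro i b
    calc _ ≤ ∑ k ∈ Finset.Ico (2 * N i * b) (2 * N i * (b + 1)),
          ∫ s in z i k..z i (k + 1), |q s| := Finset.sum_le_sum fun k _ =>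
            intervalIntegral.abs_integral_le_integral_abs ((hE.mono i).monotone k.le_succ)
      _ = ∫ s in z i (2 * N i * b)..z i (2 * N i * (b + 1)), |q s| :=
          sum_cell_integral (fun x => (hq x).norm) _ (Nat.mul_le_mul_left _ b.le_succ)
      _ ≤ Q := by
          rw [show z i (2 * N i * (b + 1)) = z i (2 * N i * b) + (A + B) by
            rw [hstart, hstart]; push_cast; ring]
          exact hQ _
  have hbd := fun i => (huv i).bounds (hgrid i) (i.succ_pos.trans_le (hN i)) hA hlev.nonneg
    (fun s hs => (le_abs_self _).trans (hGm s hs)) hGm0 (hcell i) (hnn i)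
    (fun b hb => (hrange i b hb).le hr.1 hr.2.1)
  have hlast : ∀ i, ∀ k ≤ n i, k < 2 * N i * (2 * i + 1) := by
    intro i k hk
    have hpos : 0 < 2 * N i * (2 * i + 1) := by
      have := hN i
      positivity
    simp only [hn] at hk
    omega
  have hu : ∀ i, ∀ k ≤ n i, u i k ∈ Icc 0 R := fun i k hk =>
    (hbd i k ((hlast i k hk).le.trans (Nat.le_add_right _ _))).1
  have hv := fun i k (hk : k ≤ n i) =>
    (hbd i k ((hlast i k hk).le.trans (Nat.le_add_right _ _))).2 (hlast i k hk)
  obtain ⟨φ, U, V, hφ, hUV, hV, hlim⟩ := hE.exists_limit hq hlev.cont huv hu hv hGm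
  have hEφ := hE.comp hφ.tendsto_atTop
  refine ⟨U, V, hUV, hV, fun t => ?_, fun j => ?_⟩
  · refine isClosed_Icc.mem_of_tendsto (hlim t id _ tendsto_id (fun i => gridIndex_le)
      (hEφ.tendsto_index t)) (Eventually.of_forall fun i => hu _ _ gridIndex_le)
  · refine hEφ.exists_isGreatest (u := fun i => u (φ i)) hlim (isClosed_inRange ..) j.natAbs
      fun i hi => ?_
    have hφi := hφ.id_le i
    simp only [id] at hφi
    obtain ⟨b, hb⟩ := Int.eq_ofNat_of_zero_le (show 0 ≤ j + φ i by omega)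
    have hb2 : b ≤ 2 * φ i := by omega
    have hj : ((b : ℝ) - φ i) = j := by
      have : ((b : ℤ) : ℝ) = j + φ i := by rw [← hb]; push_cast; ring
      push_cast at this
      linarith
    obtain ⟨m, hm1, hm2, hm⟩ := exists_eq_blockMax (N (φ i)) (u (φ i)) b
    refine ⟨2 * N (φ i) * b, 2 * N (φ i) * b + N (φ i), m, ?_, ?_, ?_, hm1, hm2,
      fun k hk hk' => hm ▸ le_blockMax _ hk hk', ?_⟩
    · have h1 : 2 * N (φ i) * b ≤ 2 * N (φ i) * (2 * φ i) := Nat.mul_le_mul_left _ hb2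
      have h2 := hN (φ i)
      have h3 : 2 * N (φ i) * (2 * φ i + 1) = 2 * N (φ i) * (2 * φ i) + 2 * N (φ i) := by ring
      simp only [hn]
      omega
    · rw [hstart, hj]
    · rw [hmid, hj]
    · have := hrange (φ i) b (by omega)
      rw [show (b : ℤ) - φ i = j by omega] at this
      rw [hm]
      exact this

section Weight

variable {a : ℝ → ℝ} {lam mu : ℝ}

theorem locallyIntegrable_weight (ha : LocallyIntegrable a) (lam mu : ℝ) :
    LocallyIntegrable fun t => lam * max (a t) 0 - mu * max (-a t) 0 := fun x =>
  let ⟨s, hs, h⟩ := ha x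
  ⟨s, hs, (Integrable.pos_part h |>.const_mul lam).sub (Integrable.neg_part h |>.const_mul mu)⟩

theorem periodic_weight {T : ℝ} (ha : Function.Periodic a T) (lam mu : ℝ) :
    Function.Periodic (fun t => lam * max (a t) 0 - mu * max (-a t) 0) T := fun t => by
  simp only [ha t]

theorem integral_add_int_mul {f : ℝ → ℝ} {T : ℝ} (hf : Function.Periodic f T) (m : ℤ) (x y : ℝ) :
    ∫ s in (x + m * T)..(y + m * T), f s = ∫ s in x..y, f s := by
  rw [← intervalIntegral.integral_comp_add_right f (m * T)]
  exact intervalIntegral.integral_congr fun s _ => hf.int_mul m s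

theorem integral_weight_of_nonneg {x₀ y₀ x y : ℝ} (h : ∀ᵐ t : ℝ, t ∈ Icc x₀ y₀ → 0 ≤ a t)
    (hx : x₀ ≤ x) (hxy : x ≤ y) (hy : y ≤ y₀) :
    ∫ t in x..y, (lam * max (a t) 0 - mu * max (-a t) 0) = lam * ∫ t in x..y, a t := by
  rw [← intervalIntegral.integral_const_mul]
  refine intervalIntegral.integral_congr_ae ?_
  filter_upwards [h] with t ht hmem
  rw [uIoc_of_le hxy] at hmem
  have := ht ⟨hx.trans hmem.1.le, hmem.2.trans hy⟩
  rw [max_eq_left this, max_eq_right (by linarith)]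
  ring

theorem integral_weight_of_nonpos {x₀ y₀ x y : ℝ} (h : ∀ᵐ t : ℝ, t ∈ Icc x₀ y₀ → a t ≤ 0)
    (hx : x₀ ≤ x) (hxy : x ≤ y) (hy : y ≤ y₀) :
    ∫ t in x..y, (lam * max (a t) 0 - mu * max (-a t) 0) = mu * ∫ t in x..y, a t := by
  rw [← intervalIntegral.integral_const_mul]
  refine intervalIntegral.integral_congr_ae ?_
  filter_upwards [h] with t ht hmem
  rw [uIoc_of_le hxy] at hmem
  have := ht ⟨hx.trans hmem.1.le, hmem.2.trans hy⟩
  rw [max_eq_right this, max_eq_left (by linarith)]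
  ring

theorem integral_nonneg_of_subinterval {x₀ y₀ x y : ℝ} (h : ∀ᵐ t : ℝ, t ∈ Icc x₀ y₀ → 0 ≤ a t)
    (hx : x₀ ≤ x) (hxy : x ≤ y) (hy : y ≤ y₀) : 0 ≤ ∫ t in x..y, a t := by
  refine intervalIntegral.integral_nonneg_of_ae_restrict hxy ?_
  refine (ae_restrict_iff' measurableSet_Icc).2 ?_
  filter_upwards [h] with t ht hmem
  exact ht ⟨hx.trans hmem.1, hmem.2.trans hy⟩

theorem integral_nonpos_of_subinterval {x₀ y₀ x y : ℝ} (h : ∀ᵐ t : ℝ, t ∈ Icc x₀ y₀ → a t ≤ 0)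
    (hx : x₀ ≤ x) (hxy : x ≤ y) (hy : y ≤ y₀) : ∫ t in x..y, a t ≤ 0 := by
  have := integral_nonneg_of_subinterval (a := fun t => -a t)
    (h.mono fun t ht hmem => neg_nonneg.2 (ht hmem)) hx hxy hy
  rw [intervalIntegral.integral_neg] at this
  linarith

theorem tendsto_integral_shrink (ha : LocallyIntegrable a) (x y C : ℝ) :
    Tendsto (fun K : ℕ => ∫ t in (x + C / K)..(y - C / K), a t) atTop (𝓝 (∫ t in x..y, a t)) := by
  have hi : ∀ s t, IntervalIntegrable a volume s t := fun s t =>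
    (ha.integrableOn_isCompact isCompact_uIcc).intervalIntegrable
  have hc := intervalIntegral.continuous_primitive hi 0
  have he : ∀ s t, ∫ r in s..t, a r = (∫ r in 0..t, a r) - ∫ r in 0..s, a r := fun s t =>
    (intervalIntegral.integral_interval_sub_left (hi _ _) (hi _ _)).symm
  have h0 : Tendsto (fun K : ℕ => C / (K : ℝ)) atTop (𝓝 0) :=
    tendsto_const_div_atTop_nhds_zero_nat C
  have h1 : Tendsto (fun K : ℕ => x + C / (K : ℝ)) atTop (𝓝 x) := by simpa using h0.const_add x
  have h2 : Tendsto (fun K : ℕ => y - C / (K : ℝ)) atTop (𝓝 y) := by simpa using h0.const_sub y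
  rw [he x y]
  refine Tendsto.congr (fun K => (he _ _).symm) ?_
  exact ((hc.tendsto y).comp h2).sub ((hc.tendsto x).comp h1)

end Weight

section Nonlinearity

variable {g : ℝ → ℝ}

theorem continuous_comp_max (hg : ContinuousOn g (Ici 0)) : Continuous fun s => g (max s 0) :=
  hg.comp_continuous (by fun_prop) fun s => mem_Ici.2 (le_max_right s 0)

theorem exists_pos_le (hg : ContinuousOn g (Ici 0)) (hpos : ∀ s, 0 < s → 0 < g s) {x : ℝ}
    (hx : 0 < x) (y : ℝ) : ∃ γ, 0 < γ ∧ ∀ s, x ≤ s → s ≤ y → γ ≤ g s := by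
  rcases le_or_gt x y with hxy | hxy
  · obtain ⟨s₀, hs₀, hmin⟩ := (isCompact_Icc (a := x) (b := y)).exists_isMinOn
      (nonempty_Icc.2 hxy) (hg.mono fun s hs => hx.le.trans hs.1)
    exact ⟨g s₀, hpos _ (hx.trans_le hs₀.1), fun s h1 h2 => hmin ⟨h1, h2⟩⟩
  · exact ⟨1, one_pos, fun s h1 h2 => absurd (h1.trans h2) (not_le.2 hxy)⟩

theorem exists_le_mul_near_zero (hg0 : Tendsto (fun s => g s / s) (𝓝[>] 0) (𝓝 0)) {δ : ℝ}
    (hδ : 0 < δ) {ρ : ℝ} (hρ : 0 < ρ) :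
    ∃ r, 0 < r ∧ r < ρ ∧ ∀ s, 0 < s → s ≤ r → g s ≤ δ * s := by
  obtain ⟨x, hx, h⟩ := mem_nhdsGT_iff_exists_Ioc_subset.1 (hg0.eventually (gt_mem_nhds hδ))
  have hx : 0 < x := hx
  refine ⟨min x (ρ / 2), by positivity, (min_le_right _ _).trans_lt (by linarith),
    fun s h1 h2 => ?_⟩
  have : g s / s < δ := h ⟨h1, h2.trans (min_le_left _ _)⟩
  exact ((div_lt_iff₀ h1).1 this).le

theorem exists_le_mul_far (hg : ContinuousOn g (Ici 0))
    (hginf : Tendsto (fun s => g s / s) atTop (𝓝 0)) {δ : ℝ} (hδ : 0 < δ) (ρ : ℝ) :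
    ∃ R, 0 < R ∧ ρ < R ∧ ∀ s, 0 ≤ s → s ≤ R → g s ≤ δ * R := by
  obtain ⟨X, hX⟩ := eventually_atTop.1
    ((hginf.eventually (gt_mem_nhds hδ)).and (eventually_gt_atTop 0))
  obtain ⟨C, hC⟩ := (isCompact_Icc (a := (0 : ℝ)) (b := X)).exists_bound_of_continuousOn
    (hg.mono fun s hs => hs.1)
  refine ⟨max (max 1 (ρ + 1)) (C / δ), by positivity, ?_, fun s h1 h2 => ?_⟩
  · exact (lt_add_one ρ).trans_le ((le_max_right _ _).trans (le_max_left _ _))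
  · rcases le_or_gt s X with hs | hs
    · calc g s ≤ C := (le_abs_self _).trans (hC s ⟨h1, hs⟩)
        _ = δ * (C / δ) := by field_simp
        _ ≤ _ := mul_le_mul_of_nonneg_left (le_max_right _ _) hδ.le
    · obtain ⟨h3, h4⟩ := hX s hs.le
      exact ((div_lt_iff₀ h4).1 h3).le.trans (mul_le_mul_of_nonneg_left h2 hδ.le)

theorem exists_le_mul_of_le (hg : ContinuousOn g (Ici 0)) {δ r : ℝ} (hδ : 0 ≤ δ) (hr : 0 < r)
    (hsmall : ∀ s, 0 < s → s ≤ r → g s ≤ δ * s) (R : ℝ) :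
    ∃ κ, 0 ≤ κ ∧ ∀ s, 0 < s → s ≤ R → g s ≤ κ * s := by
  obtain ⟨C, hC⟩ := (isCompact_Icc (a := (0 : ℝ)) (b := R)).exists_bound_of_continuousOn
    (hg.mono fun s hs => hs.1)
  refine ⟨max δ (C / r), le_max_of_le_left hδ, fun s h1 h2 => ?_⟩
  rcases le_or_gt s r with hs | hs
  · exact (hsmall s h1 hs).trans (mul_le_mul_of_nonneg_right (le_max_left _ _) h1.le)
  · have hC0 := (norm_nonneg _).trans (hC s ⟨h1.le, h2⟩)
    calc g s ≤ C := (le_abs_self _).trans (hC s ⟨h1.le, h2⟩)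
      _ = C / r * r := by field_simp
      _ ≤ C / r * s := mul_le_mul_of_nonneg_left hs.le (by positivity)
      _ ≤ _ := mul_le_mul_of_nonneg_right (le_max_right _ _) h1.le

end Nonlinearity

theorem stmt_14 (g a : ℝ → ℝ) (T α β : ℝ)
    (hg_cont : ContinuousOn g (Ici 0)) (hg_zero : g 0 = 0)
    (hg_pos : ∀ s : ℝ, 0 < s → 0 < g s)
    (hg0 : Tendsto (fun s => g s / s) (nhdsWithin 0 (Ioi 0)) (nhds 0))
    (hginf : Tendsto (fun s => g s / s) atTop (nhds 0))
    (hαβ : α < β) (hβ : β < α + T)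
    (ha_per : ∀ t, a (t + T) = a t)
    (ha_loc : LocallyIntegrable a)
    (ha_pos : (∀ᵐ t : ℝ ∂volume, t ∈ Icc α β → 0 ≤ a t) ∧ 0 < ∫ t in α..β, a t)
    (ha_neg : (∀ᵐ t : ℝ ∂volume, t ∈ Icc β (α + T) → a t ≤ 0) ∧
      (∫ t in β..(α + T), a t) < 0) :    ∀ ρ : ℝ, 0 < ρ → ∃ lamStar : ℝ, 0 < lamStar ∧
      ∀ lam : ℝ, lamStar < lam → ∃ r R : ℝ, 0 < r ∧ r < ρ ∧ ρ < R ∧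
        ∃ muStar : ℝ, 0 < muStar ∧ ∀ mu : ℝ, muStar < mu →
          ∀ S : ℤ → Fin 3, (∃ j, S j ≠ 0) →
            ∃ u v : ℝ → ℝ,
              IsSolR (fun t => lam * max (a t) 0 - mu * max (-a t) 0) g u v ∧
              (∀ t, 0 < u t) ∧
              ∀ j : ℤ,
                (S j = 0 → sSup (u '' Icc (α + j * T) (β + j * T)) < r) ∧
                (S j = 1 → r < sSup (u '' Icc (α + j * T) (β + j * T)) ∧
                  sSup (u '' Icc (α + j * T) (β + j * T)) < ρ) ∧
                (S j = 2 → ρ < sSup (u '' Icc (α + j * T) (β + j * T)) ∧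
                  sSup (u '' Icc (α + j * T) (β + j * T)) < R) := by
  obtain ⟨A, rfl⟩ : ∃ A, β = α + A := ⟨β - α, by ring⟩
  obtain ⟨B, rfl⟩ : ∃ B, T = A + B := ⟨T - A, by ring⟩
  rw [← add_assoc] at hβ ha_neg
  have hA : 0 < A := by linarith
  have hB : 0 < B := by linarith
  have hT : 0 < A + B := by linarith
  obtain ⟨hsign, hw0⟩ := ha_pos
  obtain ⟨hsign', hd⟩ := ha_neg
  have hK := ((tendsto_integral_shrink ha_loc α (α + A) A).eventually (lt_mem_nhds hw0)).and
    (((tendsto_integral_shrink ha_loc (α + A) (α + A + B) B).eventually (gt_mem_nhds hd)).and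
      (eventually_ge_atTop 2))
  obtain ⟨K, hc0, hd0, hK2⟩ := hK.exists
  have hK0 : (0 : ℝ) < K := by exact_mod_cast (show 0 < K by omega)
  set c := ∫ t in (α + A / K)..(α + A - A / K), a t with hc
  set w := ∫ t in α..(α + A), a t with hw
  set d := ∫ t in (α + A + B / K)..(α + A + B - B / K), a t with hd'
  intro ρ hρ
  obtain ⟨γ, hγ0, hγ⟩ := exists_pos_le hg_cont hg_pos (show 0 < ρ / 2 / K by positivity) (2 * ρ)
  refine ⟨4 * ρ / (A / K * c * γ), by positivity, fun lam hlam => ?_⟩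
  have hlam0 : 0 < lam := lt_trans (by positivity) hlam
  rw [div_lt_iff₀ (by positivity)] at hlam
  set δ := 1 / (2 * ((A + B) * (lam * w))) with hδ
  have hδ0 : 0 < δ := by positivity
  have hδ1 : (A + B) * (lam * w * δ) = 1 / 2 := by
    rw [hδ]
    field_simp
  obtain ⟨r₁, hr₁, hr₁ρ, hsmall⟩ := exists_le_mul_near_zero hg0 hδ0 (half_pos hρ)
  obtain ⟨R₀, hR₀, hρR, hlarge⟩ := exists_le_mul_far hg_cont hginf hδ0 (2 * ρ)
  obtain ⟨γ', hγ'0, hγ'⟩ := exists_pos_le hg_cont hg_pos (show 0 < r₁ / 2 / 2 by positivity) R₀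
  obtain ⟨κ, hκ0, hκ⟩ := exists_le_mul_of_le hg_cont hδ0.le hr₁ hsmall R₀
  refine ⟨3 / 4 * r₁, R₀ + 1, by positivity, by linarith, by linarith,
    2 * R₀ / (B / K * -d * γ'), div_pos (by positivity)
      (mul_pos (mul_pos (by positivity) (by linarith)) hγ'0), fun mu hmu S hS => ?_⟩
  have hmu0 : 0 < mu := lt_trans (div_pos (by positivity)
    (mul_pos (mul_pos (by positivity) (by linarith)) hγ'0)) hmu
  rw [div_lt_iff₀ (mul_pos (mul_pos (by positivity) (by linarith)) hγ'0)] at hmu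
  have hlev : Levels (fun s => g (max s 0)) A (A + B) (A / K) (B / K) (lam * c) (lam * w)
      (mu * -d) (r₁ / 2) r₁ (ρ / 2) (2 * ρ) R₀ := by
    refine ⟨continuous_comp_max hg_cont, fun s => ?_, by simp [hg_zero], by positivity,
      by positivity, by positivity, by linarith, hr₁ρ, by linarith, hρR,
      ⟨δ, hδ0.le, hδ1.le, ?_⟩, ⟨γ', hγ'0.le, by nlinarith, ?_⟩, ?_⟩
    · rcases (le_max_right s 0).eq_or_lt with h | h
      · rw [← h, hg_zero]
      · exact (hg_pos _ h).le
    · intro L hL s hs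
      have hL0 : 0 < L := by rcases hL with rfl | rfl | rfl <;> positivity
      rcases le_or_gt s 0 with h0 | h0
      · rw [max_eq_right h0, hg_zero]
        positivity
      rw [max_eq_left h0.le]
      have hLr : L ≤ r₁ → g s ≤ δ * L := fun hLr =>
        (hsmall s h0 (hs.trans hLr)).trans (mul_le_mul_of_nonneg_left hs hδ0.le)
      rcases hL with rfl | rfl | rfl
      · exact hLr (by linarith)
      · exact hLr le_rfl
      · exact hlarge s h0.le hs
    · intro s h1 h2
      rw [max_eq_left (le_trans (by positivity) h1)]
      exact hγ' s h1 h2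
    · intro L hL
      have hL2 : ρ / 2 ≤ L ∧ L ≤ 2 * ρ := by
        rcases hL with rfl | rfl <;> constructor <;> linarith
      refine ⟨γ, hγ0.le, by nlinarith, fun s h1 h2 => ?_⟩
      have h3 : L * (A / K) / A = L / K := by field_simp
      have h4 : ρ / 2 / K ≤ s := by
        refine le_trans ?_ (h3 ▸ h1)
        gcongr
        exact hL2.1
      rw [max_eq_left (le_trans (by positivity) h4)]
      exact hγ s h4 (h2.trans hL2.2)
  have hper := periodic_weight ha_per lam mu
  have hq := locallyIntegrable_weight ha_loc lam mu
  obtain ⟨U, V, hU, hV, hUR, hM⟩ := exists_solution_inRange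
    (Q := ∫ s in 0..(0 + (A + B)), |lam * max (a s) 0 - mu * max (-a s) 0|) hA hB hlam0 hmu0 hq
    (fun m x y h1 h2 h3 => (integral_add_int_mul hper m x y).trans
      (integral_weight_of_nonneg hsign h1 h2 h3))
    (fun m x y h1 h2 h3 => (integral_add_int_mul hper m x y).trans
      (integral_weight_of_nonpos hsign' h1 h2 h3))
    (fun x y => integral_nonneg_of_subinterval hsign)
    (fun x y => integral_nonpos_of_subinterval hsign')
    (fun x => ((hper.comp abs).intervalIntegral_add_eq x 0).le) hK2 hlev S
  have hUmax : ∀ t, max (U t) 0 = U t := fun t => max_eq_left (hUR t).1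
  simp only [hUmax] at hV
  refine ⟨U, V, ⟨hU, hV⟩, fun t => ?_, fun j => ?_⟩
  · refine (hUR t).1.lt_of_ne fun h0 => ?_
    have hzero := eq_zero_of_exists_zero hq hU hV (fun t => (hUR t).1) hκ0 (fun t => ?_) h0.symm
    · obtain ⟨j, hj⟩ := hS
      obtain ⟨M, hMr, ⟨t₁, -, rfl⟩, -⟩ := hM j
      rw [hzero t₁] at hMr
      obtain ⟨-, h1, h2⟩ := hMr
      generalize S j = i at hj h1 h2
      fin_cases i
      · exact hj rfl
      · linarith [(h1 rfl).1]
      · linarith [(h2 rfl).1]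
    · rcases (hUR t).1.eq_or_lt with h | h
      · rw [← h, hg_zero]
        simp
      · rw [abs_of_pos (hg_pos _ h)]
        exact hκ _ h (hUR t).2
  · obtain ⟨M, ⟨h0, h1, h2⟩, hgr⟩ := hM j
    rw [hgr.csSup_eq]
    refine ⟨fun h => ?_, fun h => ?_, fun h => ?_⟩
    · linarith [h0 h]
    · constructor <;> linarith [h1 h]
    · constructor <;> linarith [h2 h]
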